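/- arXiv:2304.02318 — 2 statements merged into one kernel-verified Lean document; each statement's English description precedes it below -/
import Mathlib

section
/- Let Ω ⊆ ℂⁿ be open and connected, f analytic on Ω, and P ∈ ℂ[z₁,…,zₙ] a square-free polynomial. If f vanishes on the zero set Z(P) ∩ Ω of P, then f/P extends to a function analytic on Ω; that is, there exists g analytic on Ω with f = g·P on Ω. -/
open MvPolynomial

section Algebra

theorem Squarefree.polynomial_C {R : Type*} [CommRing R] [IsDomain R] {p : R} (hp : Squarefree p) :
    Squarefree (Polynomial.C p) := by
  intro q hq
  have hp0 : Polynomial.C p ≠ 0 := Polynomial.C_ne_zero.2 hp.ne_zero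
  have hdeg := Polynomial.natDegree_le_of_dvd ((dvd_mul_right q q).trans hq) hp0
  obtain ⟨c, rfl⟩ := Polynomial.natDegree_eq_zero.1 (Nat.le_zero.1 (by simpa using hdeg))
  rw [← Polynomial.C_mul, Polynomial.C_dvd_iff_dvd_coeff] at hq
  exact (hp c (by simpa using hq 0)).map Polynomial.C

theorem Squarefree.map_ringEquiv {R S : Type*} [CommRing R] [CommRing S] (e : R ≃+* S) {p : R}
    (hp : Squarefree p) : Squarefree (e p) := by
  intro q hq
  have h := map_dvd e.symm hq
  rw [map_mul, e.symm_apply_apply] at h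
  simpa using (hp _ h).map e

theorem Squarefree.map_fractionRing {R K : Type*} [CommRing R] [IsDomain R]
    [UniqueFactorizationMonoid R] [Field K] [Algebra R K] [IsFractionRing R K]
    {p : Polynomial R} (hp : Squarefree p) : Squarefree (p.map (algebraMap R K)) := by
  let _ : NormalizationMonoid R := Nonempty.some inferInstance
  let _ : NormalizedGCDMonoid R := UniqueFactorizationMonoid.toNormalizedGCDMonoid R
  have hinj : Function.Injective (algebraMap R K) := IsFractionRing.injective R K
  intro q hq
  have hq0 : q ≠ 0 := by
    rintro rfl
    rw [zero_mul, zero_dvd_iff, Polynomial.map_eq_zero_iff hinj] at hq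
    exact hp.ne_zero hq
  obtain ⟨b, hb, hbq⟩ := IsLocalization.integerNormalization_spec (nonZeroDivisors R) q
  set q₀ := IsLocalization.integerNormalization (nonZeroDivisors R) q
  have hb0 : algebraMap R K b ≠ 0 := by
    simpa using (map_ne_zero_iff _ hinj).2 (nonZeroDivisors.ne_zero hb)
  have hbq' : q₀.map (algebraMap R K) = Polynomial.C (algebraMap R K b) * q := by
    rw [hbq, ← Polynomial.smul_eq_C_mul, algebraMap_smul]
  have hq₀ : q₀ ≠ 0 := by
    intro h
    rw [h, Polynomial.map_zero] at hbq'
    exact mul_ne_zero (Polynomial.C_ne_zero.2 hb0) hq0 hbq'.symm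
  have hassoc : Associated (q₀.primPart.map (algebraMap R K)) q := by
    have h1 : Associated (q₀.map (algebraMap R K)) q := by
      rw [hbq']
      exact associated_unit_mul_left _ _ (Polynomial.isUnit_C.2 hb0.isUnit)
    refine Associated.trans ?_ h1
    nth_rw 2 [q₀.eq_C_content_mul_primPart]
    rw [Polynomial.map_mul, Polynomial.map_C]
    refine (associated_unit_mul_left _ _ (Polynomial.isUnit_C.2 (Ne.isUnit ?_))).symm
    exact (map_ne_zero_iff _ hinj).2 (Polynomial.content_eq_zero_iff.not.2 hq₀)
  have hdvd : (q₀.primPart * q₀.primPart).map (algebraMap R K) ∣ p.map (algebraMap R K) := by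
    rw [Polynomial.map_mul]
    exact (hassoc.mul_mul hassoc).dvd.trans hq
  have hprim := q₀.isPrimitive_primPart.mul q₀.isPrimitive_primPart
  have hu := hp _ (hprim.dvd_of_fraction_map_dvd_fraction_map hdvd)
  exact hassoc.isUnit (hu.map (Polynomial.mapRingHom (algebraMap R K)))

theorem Squarefree.exists_mul_add_mul_derivative_eq_C {R : Type*} [CommRing R] [IsDomain R]
    [UniqueFactorizationMonoid R] [CharZero R] {p : Polynomial R} (hp : Squarefree p) :
    ∃ (a b : Polynomial R) (d : R), d ≠ 0 ∧
      a * p + b * Polynomial.derivative p = Polynomial.C d := by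
  let K := FractionRing R
  have hinj : Function.Injective (algebraMap R K) := IsFractionRing.injective R K
  have : CharZero K := IsFractionRing.charZero_of_isFractionRing R
  have hsep := PerfectField.separable_iff_squarefree.2 (hp.map_fractionRing (K := K))
  obtain ⟨a, b, hab⟩ := hsep
  obtain ⟨c, hc, hca⟩ := IsLocalization.integerNormalization_spec (nonZeroDivisors R) a
  obtain ⟨e, he, heb⟩ := IsLocalization.integerNormalization_spec (nonZeroDivisors R) b
  refine ⟨Polynomial.C e * IsLocalization.integerNormalization (nonZeroDivisors R) a,
    Polynomial.C c * IsLocalization.integerNormalization (nonZeroDivisors R) b, c * e,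
    mul_ne_zero (nonZeroDivisors.ne_zero hc) (nonZeroDivisors.ne_zero he), ?_⟩
  apply Polynomial.map_injective _ hinj
  rw [Polynomial.derivative_map] at hab
  rw [← algebraMap_smul K, Polynomial.smul_eq_C_mul] at hca heb
  simp only [Polynomial.map_add, Polynomial.map_mul, Polynomial.map_C, hca, heb, map_mul]
  linear_combination (Polynomial.C (algebraMap R K c) * Polynomial.C (algebraMap R K e)) * hab

variable {σ : Type*}

/-- The ring endomorphism of `R[z][t]` fixing `t` and sending `z` to `z + t v`. -/
noncomputable def MvPolynomial.shear {R : Type*} [CommRing R] (v : σ → R) :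
    Polynomial (MvPolynomial σ R) →+* Polynomial (MvPolynomial σ R) :=
  Polynomial.eval₂RingHom
    (eval₂Hom (Polynomial.C.comp C)
      fun i => Polynomial.C (X i) + Polynomial.C (C (v i)) * Polynomial.X)
    Polynomial.X

theorem MvPolynomial.shear_comp_shear_neg {R : Type*} [CommRing R] (v : σ → R) :
    (shear v).comp (shear (-v)) = RingHom.id _ := by
  ext1
  · ext1
    · ext1; simp [shear]
    · simp [shear]
      ring
  · simp [shear]

theorem MvPolynomial.shear_neg_comp_shear {R : Type*} [CommRing R] (v : σ → R) :
    (shear (-v)).comp (shear v) = RingHom.id _ := by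
  simpa using shear_comp_shear_neg (-v)

/-- The restriction of `P` to the line `t ↦ z + t v`, with `z` generic. -/
noncomputable def MvPolynomial.alongLine {R : Type*} [CommRing R] (v : σ → R)
    (P : MvPolynomial σ R) : Polynomial (MvPolynomial σ R) :=
  shear v (Polynomial.C P)

theorem MvPolynomial.squarefree_alongLine {R : Type*} [CommRing R] [IsDomain R] (v : σ → R)
    {P : MvPolynomial σ R} (hP : Squarefree P) : Squarefree (alongLine v P) :=
  hP.polynomial_C.map_ringEquiv
    (RingEquiv.ofRingHom (shear v) (shear (-v)) (shear_comp_shear_neg v) (shear_neg_comp_shear v))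

theorem MvPolynomial.eval_map_alongLine {R : Type*} [CommRing R] (v z : σ → R)
    (P : MvPolynomial σ R) (t : R) :
    ((alongLine v P).map (eval z)).eval t = eval (z + t • v) P := by
  induction P using MvPolynomial.induction_on with
  | C a => simp [alongLine, shear]
  | add p q hp hq => simp_all [alongLine]
  | mul_X p i hp =>
    rw [alongLine, map_mul, map_mul, ← alongLine, Polynomial.map_mul, Polynomial.eval_mul, hp]
    simp [shear, mul_comm t]

/-- A squarefree polynomial has only simple zeros on a generic line of given direction. -/
theorem MvPolynomial.exists_ne_zero_forall_separable_alongLine {K : Type*} [Field K] [CharZero K]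
    (v : σ → K) {P : MvPolynomial σ K} (hP : Squarefree P) :
    ∃ d : MvPolynomial σ K, d ≠ 0 ∧
      ∀ z, eval z d ≠ 0 → ((alongLine v P).map (eval z)).Separable := by
  obtain ⟨a, b, d, hd, h⟩ := (squarefree_alongLine v hP).exists_mul_add_mul_derivative_eq_C
  refine ⟨d, hd, fun z hz => ?_⟩
  have h' := congrArg (Polynomial.map (eval z)) h
  simp only [Polynomial.map_add, Polynomial.map_mul, Polynomial.map_C,
    ← Polynomial.derivative_map] at h'
  refine ⟨Polynomial.C (eval z d)⁻¹ * a.map (eval z),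
    Polynomial.C (eval z d)⁻¹ * b.map (eval z), ?_⟩
  rw [mul_assoc, mul_assoc, ← mul_add, h', ← Polynomial.C_mul, inv_mul_cancel₀ hz, Polynomial.C_1]

end Algebra

section Analysis

open Metric Set Filter Topology Real

theorem DifferentiableOn.exists_eq_mul_prod_sub {U : Set ℂ} (hU : IsOpen U) (S : Finset ℂ) :
    ∀ {F : ℂ → ℂ}, DifferentiableOn ℂ F U → (∀ t ∈ U, t ∈ S → F t = 0) →
      ∃ h : ℂ → ℂ, DifferentiableOn ℂ h U ∧ ∀ t ∈ U, F t = h t * ∏ s ∈ S, (t - s) := by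
  induction S using Finset.induction_on with
  | empty => exact fun {F} hF _ => ⟨F, hF, by simp⟩
  | insert s S hs ih =>
    intro F hF hvan
    obtain ⟨G, hG, hFG⟩ : ∃ G : ℂ → ℂ, DifferentiableOn ℂ G U ∧
        ∀ t ∈ U, F t = (t - s) * G t := by
      by_cases hsU : s ∈ U
      · refine ⟨dslope F s,
          (Complex.differentiableOn_dslope (hU.mem_nhds hsU)).2 hF, fun t _ => ?_⟩
        rw [← smul_eq_mul, sub_smul_dslope, hvan s hsU (Finset.mem_insert_self s S), sub_zero]
      · have hne : ∀ t ∈ U, t - s ≠ 0 := fun t ht h => hsU (sub_eq_zero.1 h ▸ ht)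
        refine ⟨fun t => F t / (t - s), hF.div (by fun_prop) hne, fun t ht => ?_⟩
        exact (mul_div_cancel₀ _ (hne t ht)).symm
    obtain ⟨h, hh, hGh⟩ := ih hG fun t ht htS => by
      have hts : t - s ≠ 0 := fun h => hs (sub_eq_zero.1 h ▸ htS)
      have := hFG t ht
      rw [hvan t ht (Finset.mem_insert_of_mem htS)] at this
      exact (mul_eq_zero.1 this.symm).resolve_left hts
    refine ⟨h, hh, fun t ht => ?_⟩
    rw [hFG t ht, hGh t ht, Finset.prod_insert hs]
    ring

/-- One-variable division by a polynomial with simple roots. -/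
theorem DifferentiableOn.exists_eq_mul_eval_of_separable {U : Set ℂ} (hU : IsOpen U)
    {q : Polynomial ℂ} (hq : q.Separable) {F : ℂ → ℂ} (hF : DifferentiableOn ℂ F U)
    (hvan : ∀ t ∈ U, q.eval t = 0 → F t = 0) :
    ∃ h : ℂ → ℂ, DifferentiableOn ℂ h U ∧ ∀ t ∈ U, F t = h t * q.eval t := by
  have hq0 : q ≠ 0 := hq.ne_zero
  have hlc : q.leadingCoeff ≠ 0 := Polynomial.leadingCoeff_ne_zero.2 hq0
  obtain ⟨h, hh, hFh⟩ := DifferentiableOn.exists_eq_mul_prod_sub hU q.roots.toFinset hF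
    fun t ht htS => hvan t ht (by simpa [hq0] using htS)
  have heval : ∀ t, q.eval t = q.leadingCoeff * ∏ s ∈ q.roots.toFinset, (t - s) := by
    intro t
    have hval : q.roots.toFinset.val = q.roots :=
      Multiset.dedup_eq_self.2 (Polynomial.nodup_roots hq)
    conv_lhs => rw [(IsAlgClosed.splits q).eq_prod_roots]
    rw [Finset.prod, hval]
    simp [Polynomial.eval_multiset_prod]
  refine ⟨fun t => h t / q.leadingCoeff, hh.div_const _, fun t ht => ?_⟩
  rw [hFh t ht, heval]
  field_simp

variable {E : Type*} [NormedAddCommGroup E] [NormedSpace ℂ E]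

theorem DifferentiableOn.exists_norm_fderiv_le_of_isCompact [ProperSpace E] {V K : Set E}
    {φ : E → ℂ} (hφ : DifferentiableOn ℂ φ V) (hV : IsOpen V) (hK : IsCompact K) (hKV : K ⊆ V) :
    ∃ δ > 0, ∃ M, thickening δ K ⊆ V ∧ ∀ x ∈ thickening δ K, ‖fderiv ℂ φ x‖ ≤ M := by
  obtain ⟨ε, hε, hεV⟩ := hK.exists_cthickening_subset_open hV hKV
  obtain ⟨B, hB⟩ := (hK.cthickening (r := ε)).exists_bound_of_continuousOn
    (hφ.continuousOn.mono hεV)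
  have hsub : ∀ x ∈ thickening (ε / 2) K, ball x (ε / 2) ⊆ cthickening ε K := by
    intro x hx y hy
    obtain ⟨k, hk, hxk⟩ := mem_thickening_iff.1 hx
    refine mem_cthickening_of_dist_le y k ε K hk ?_
    have := dist_triangle y x k
    rw [mem_ball] at hy
    linarith
  refine ⟨ε / 2, half_pos hε, 2 * B / (ε / 2), ?_, fun x hx => ?_⟩
  · exact fun x hx => hεV (hsub x hx (mem_ball_self (half_pos hε)))
  · refine Complex.norm_fderiv_le_div_of_mapsTo_ball
      (hφ.mono ((hsub x hx).trans hεV)) (fun y hy => ?_) (half_pos hε)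
    rw [mem_closedBall, dist_eq_norm]
    have h1 := hB y (hsub x hx hy)
    have h2 := hB x (hsub x hx (mem_ball_self (half_pos hε)))
    linarith [norm_sub_le (φ y) (φ x)]

theorem DifferentiableOn.differentiableAt_circleAverage_line [FiniteDimensional ℂ E] {V : Set E}
    {φ : E → ℂ} (hφ : DifferentiableOn ℂ φ V) (hV : IsOpen V) {a v : E} {r : ℝ} (hr : 0 ≤ r)
    (ha : ∀ s ∈ sphere (0 : ℂ) r, a + s • v ∈ V) :
    DifferentiableAt ℂ (fun z => circleAverage (fun s => φ (z + s • v)) 0 r) a := by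
  have : ProperSpace E := FiniteDimensional.proper ℂ E
  borelize E
  have hK : IsCompact ((fun s : ℂ => a + s • v) '' sphere 0 r) :=
    (isCompact_sphere 0 r).image (by fun_prop)
  obtain ⟨δ, hδ, M, hδV, hM⟩ := hφ.exists_norm_fderiv_le_of_isCompact hV hK
    (image_subset_iff.2 ha)
  have hmem : ∀ z ∈ ball a δ, ∀ θ : ℝ, z + circleMap 0 r θ • v ∈
      thickening δ ((fun s : ℂ => a + s • v) '' sphere 0 r) := fun z hz θ =>
    mem_thickening_iff.2 ⟨a + circleMap 0 r θ • v,
      mem_image_of_mem _ (circleMap_mem_sphere 0 hr θ), by simpa using hz⟩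
  have hcont : ∀ z ∈ ball a δ, Continuous fun θ : ℝ => φ (z + circleMap 0 r θ • v) :=
    fun z hz => hφ.continuousOn.comp_continuous (by fun_prop) fun θ => hδV (hmem z hz θ)
  have key := intervalIntegral.hasFDerivAt_integral_of_dominated_of_fderiv_le
    (μ := MeasureTheory.volume) (𝕜 := ℂ) (a := 0) (b := 2 * π) (x₀ := a) (s := ball a δ)
    (F := fun z θ => φ (z + circleMap 0 r θ • v))
    (F' := fun z θ => fderiv ℂ φ (z + circleMap 0 r θ • v)) (bound := fun _ => M)
    (ball_mem_nhds a hδ)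
    (by
      filter_upwards [ball_mem_nhds a hδ] with z hz
      exact (hcont z hz).aestronglyMeasurable)
    ((hcont a (mem_ball_self hδ)).intervalIntegrable _ _)
    ((measurable_fderiv ℂ φ).comp
      (by fun_prop : Continuous fun θ : ℝ => a + circleMap 0 r θ • v).measurable).aestronglyMeasurable
    (.of_forall fun θ _ z hz => hM _ (hmem z hz θ))
    intervalIntegrable_const
    (.of_forall fun θ _ z hz => by
      have h1 := (hφ.differentiableAt (hV.mem_nhds (hδV (hmem z hz θ)))).hasFDerivAt
      exact (hasFDerivAt_comp_add_right _).2 h1)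
  exact key.differentiableAt.const_smul _

end Analysis

section LocalDivision

open Metric Set Filter Topology Real

theorem MvPolynomial.dense_setOf_eval_ne_zero {n : ℕ} {P : MvPolynomial (Fin n) ℂ} (hP : P ≠ 0) :
    Dense {z : Fin n → ℂ | eval z P ≠ 0} := by
  rw [Metric.dense_iff]
  intro a r hr
  by_contra hne
  rw [Set.not_nonempty_iff_eq_empty, Set.eq_empty_iff_forall_notMem] at hne
  refine hP (funext_set (fun i => ball (a i) r)
    (fun i => infinite_of_mem_nhds (a i) (ball_mem_nhds _ hr)) fun z hz => ?_)
  rw [map_zero]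
  by_contra hz0
  rw [← ball_pi a hr] at hz
  exact hne z ⟨hz, hz0⟩

theorem isOpen_setOf_forall_mem_add_smul_mem {E : Type*} [NormedAddCommGroup E] [NormedSpace ℂ E]
    {K : Set ℂ} (hK : IsCompact K) {V : Set E} (hV : IsOpen V) (v : E) :
    IsOpen {z : E | ∀ s ∈ K, z + s • v ∈ V} := by
  refine isOpen_iff_mem_nhds.2 fun z hz => ?_
  refine hK.eventually_forall_of_forall_eventually fun s hs => ?_
  have hc : Continuous fun p : E × ℂ => p.1 + p.2 • v := by fun_prop
  exact hc.continuousAt.eventually_mem (hV.mem_nhds (hz s hs))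

variable {n : ℕ} {Ω : Set (Fin n → ℂ)} {f : (Fin n → ℂ) → ℂ} {P : MvPolynomial (Fin n) ℂ}

theorem MvPolynomial.differentiable_eval (P : MvPolynomial (Fin n) ℂ) :
    Differentiable ℂ fun z => eval z P := by
  induction P using MvPolynomial.induction_on with
  | C a => simp
  | add p q hp hq => simpa using hp.fun_add hq
  | mul_X p i hp => simpa using hp.fun_mul (differentiable_apply i)

theorem DifferentiableOn.circleAverage_div_mul_eval (hΩ : IsOpen Ω) (hf : DifferentiableOn ℂ f Ω)
    (hvan : ∀ z ∈ Ω, eval z P = 0 → f z = 0) {z v : Fin n → ℂ} {r : ℝ} (hr : 0 ≤ r)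
    (hz : ∀ s ∈ closedBall (0 : ℂ) r, z + s • v ∈ Ω)
    (hP : ∀ s ∈ sphere (0 : ℂ) r, eval (z + s • v) P ≠ 0)
    (hsep : ((alongLine v P).map (eval z)).Separable) :
    f z = circleAverage (fun s => f (z + s • v) / eval (z + s • v) P) 0 r * eval z P := by
  have hU : IsOpen {s : ℂ | z + s • v ∈ Ω} :=
    hΩ.preimage (by fun_prop : Continuous fun s : ℂ => z + s • v)
  have hF : DifferentiableOn ℂ (fun s : ℂ => f (z + s • v)) {s : ℂ | z + s • v ∈ Ω} :=
    hf.comp (by fun_prop) fun s hs => hs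
  obtain ⟨h, hh, hfh⟩ := hF.exists_eq_mul_eval_of_separable hU hsep fun s hs h0 =>
    hvan _ hs (by rwa [eval_map_alongLine] at h0)
  simp only [eval_map_alongLine] at hfh
  have havg : circleAverage (fun s => f (z + s • v) / eval (z + s • v) P) 0 r = h 0 := by
    rw [← DiffContOnCl.circleAverage (f := h) (c := 0) (R := r)]
    · refine circleAverage_congr_sphere fun s hs => ?_
      rw [abs_of_nonneg hr] at hs
      exact (div_eq_iff (hP s hs)).2 (hfh s (hz s (sphere_subset_closedBall hs)))
    · rw [abs_of_nonneg hr]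
      exact (hh.mono fun s hs => hz s (closure_ball_subset_closedBall hs)).diffContOnCl
  rw [havg]
  simpa using hfh 0 (hz 0 (mem_closedBall_self hr))

theorem exists_local_div_squarefree (hΩ : IsOpen Ω) (hf : DifferentiableOn ℂ f Ω)
    (hP : Squarefree P) (hvan : ∀ z ∈ Ω, eval z P = 0 → f z = 0) {a : Fin n → ℂ} (ha : a ∈ Ω) :
    ∃ (W : Set (Fin n → ℂ)) (g : (Fin n → ℂ) → ℂ), IsOpen W ∧ a ∈ W ∧ W ⊆ Ω ∧
      DifferentiableOn ℂ g W ∧ ∀ z ∈ W, f z = g z * eval z P := by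
  obtain ⟨w, hw⟩ := (dense_setOf_eval_ne_zero hP.ne_zero).nonempty
  obtain ⟨v, rfl⟩ : ∃ v, w = a + v := ⟨w - a, by simp⟩
  have hQ : (alongLine v P).map (eval a) ≠ 0 := by
    intro h
    have := eval_map_alongLine v a P 1
    rw [h, one_smul, Polynomial.eval_zero] at this
    exact hw this.symm
  have hU : {s : ℂ | a + s • v ∈ Ω} ∈ 𝓝 0 :=
    (hΩ.preimage (by fun_prop : Continuous fun s : ℂ => a + s • v)).mem_nhds (by simpa using ha)
  obtain ⟨ρ, hρ, hρU⟩ := Metric.mem_nhds_iff.1 hU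
  obtain ⟨r, ⟨hr0, hrρ⟩, hr⟩ := (Ioo_infinite hρ).exists_notMem_finset
    (((alongLine v P).map (eval a)).roots.toFinset.image norm)
  have hVP : IsOpen {z : Fin n → ℂ | eval z P ≠ 0} :=
    isOpen_ne.preimage P.differentiable_eval.continuous
  let W : Set (Fin n → ℂ) := {z | ∀ s ∈ closedBall (0 : ℂ) r, z + s • v ∈ Ω} ∩
    {z | ∀ s ∈ sphere (0 : ℂ) r, z + s • v ∈ {z | eval z P ≠ 0}}
  have hW : IsOpen W :=
    (isOpen_setOf_forall_mem_add_smul_mem (isCompact_closedBall 0 r) hΩ v).inter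
      (isOpen_setOf_forall_mem_add_smul_mem (isCompact_sphere 0 r) hVP v)
  have hWΩ : W ⊆ Ω := fun z hz => by simpa using hz.1 0 (mem_closedBall_self hr0.le)
  have haW : a ∈ W := by
    refine ⟨fun s hs => hρU (closedBall_subset_ball hrρ hs), fun s hs h0 => hr ?_⟩
    rw [Finset.mem_image]
    refine ⟨s, ?_, by simpa using hs⟩
    rw [Multiset.mem_toFinset, Polynomial.mem_roots hQ, Polynomial.IsRoot, eval_map_alongLine, h0]
  have hφ : DifferentiableOn ℂ (fun z => f z / eval z P) (Ω ∩ {z | eval z P ≠ 0}) := by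
    simp only [div_eq_mul_inv]
    exact (hf.mono inter_subset_left).fun_mul
      (P.differentiable_eval.differentiableOn.fun_inv fun z hz => hz.2)
  have hg : DifferentiableOn ℂ
      (fun z => circleAverage (fun s => f (z + s • v) / eval (z + s • v) P) 0 r) W := fun z hz =>
    (hφ.differentiableAt_circleAverage_line (hΩ.inter hVP) hr0.le fun s hs =>
      ⟨hz.1 s (sphere_subset_closedBall hs), hz.2 s hs⟩).differentiableWithinAt
  obtain ⟨d, hd, hsep⟩ := exists_ne_zero_forall_separable_alongLine v hP
  refine ⟨W, _, hW, haW, hWΩ, hg, ?_⟩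
  have hEq : EqOn f (fun z => circleAverage (fun s => f (z + s • v) / eval (z + s • v) P) 0 r *
      eval z P) (W ∩ {z | eval z d ≠ 0}) := fun z hz =>
    hf.circleAverage_div_mul_eval hΩ hvan hr0.le hz.1.1 hz.1.2 (hsep z hz.2)
  exact hEq.of_subset_closure (hf.continuousOn.mono hWΩ)
    (hg.continuousOn.mul P.differentiable_eval.continuous.continuousOn) inter_subset_left
    ((dense_setOf_eval_ne_zero hd).open_subset_closure_inter hW)

end LocalDivision

/-- If `f` is analytic on a connected open set `Ω ⊆ ℂⁿ` and vanishes on the zero set of a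
square-free polynomial `P`, then `f/P` is analytic on `Ω`: there is `g` analytic on `Ω`
with `f = g·P`. -/
theorem analytic_div_squarefree {n : ℕ} (Ω : Set (Fin n → ℂ)) (hΩ : IsOpen Ω)
    (hconn : IsConnected Ω) (f : (Fin n → ℂ) → ℂ) (hf : DifferentiableOn ℂ f Ω)
    (P : MvPolynomial (Fin n) ℂ) (hP : Squarefree P)
    (hvan : ∀ z ∈ Ω, MvPolynomial.eval z P = 0 → f z = 0) :
    ∃ g : (Fin n → ℂ) → ℂ, DifferentiableOn ℂ g Ω ∧
      ∀ z ∈ Ω, f z = g z * MvPolynomial.eval z P := by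
  choose! W g hW haW hWΩ hg hfg using
    fun a (ha : a ∈ Ω) => exists_local_div_squarefree hΩ hf hP hvan ha
  have hdense := dense_setOf_eval_ne_zero hP.ne_zero
  have hagree : ∀ a ∈ Ω, ∀ b ∈ Ω, Set.EqOn (g a) (g b) (W a ∩ W b) := by
    intro a ha b hb
    have hEq : Set.EqOn (g a) (g b) (W a ∩ W b ∩ {z | eval z P ≠ 0}) := fun z hz =>
      mul_right_cancel₀ hz.2 ((hfg a ha z hz.1.1).symm.trans (hfg b hb z hz.1.2))
    exact hEq.of_subset_closure ((hg a ha).continuousOn.mono Set.inter_subset_left)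
      ((hg b hb).continuousOn.mono Set.inter_subset_right) Set.inter_subset_left
      (hdense.open_subset_closure_inter ((hW a ha).inter (hW b hb)))
  refine ⟨fun z => g z z, fun a ha => ?_, fun z hz => hfg z hz z (haW z hz)⟩
  have hnhds : W a ∈ nhds a := (hW a ha).mem_nhds (haW a ha)
  refine (((hg a ha).differentiableAt hnhds).congr_of_eventuallyEq ?_).differentiableWithinAt
  filter_upwards [hnhds] with z hz
  exact hagree z (hWΩ a ha hz) a ha ⟨haW z (hWΩ a ha hz), hz⟩
end

section
/- Let V ⊆ ℂⁿ be an irreducible affine variety of dimension d defined by n−d real polynomials P₁,…,P_{n−d} ∈ ℝ[X], and suppose V has a point a ∈ V ∩ ℝⁿ that is a smooth point of V (the Jacobian of (P₁,…,P_{n−d}) has rank n−d at a). Then any function f analytic on V that vanishes on V ∩ ℝⁿ vanishes identically on V. -/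
open MvPolynomial
open Filter Topology

theorem MultilinearMap.exists_mvPolynomial_eval_diag {s k : ℕ}
    (p : MultilinearMap ℂ (fun _ : Fin k => (Fin s → ℂ)) ℂ) :
    ∃ Q : MvPolynomial (Fin s) ℂ, ∀ y, p (fun _ => y) = MvPolynomial.eval y Q := by
  refine ⟨∑ r : Fin k → Fin s, (∏ j, X (r j)) * C (p fun j => Pi.single (r j) 1), fun y => ?_⟩
  have hy : y = ∑ i, y i • (Pi.single i 1 : Fin s → ℂ) := pi_eq_sum_univ' y
  conv_lhs => rw [hy]
  rw [p.map_sum]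
  simp [map_prod, p.map_smul_univ]

theorem Complex.iteratedDeriv_eq_zero_of_growth {v : ℂ → ℂ} (hv : Differentiable ℂ v)
    {C : ℝ} {N : ℕ} (hb : ∀ t, ‖v t‖ ≤ C * (1 + ‖t‖) ^ N) {k : ℕ} (hk : N < k) :
    iteratedDeriv k v 0 = 0 := by
  have hC : 0 ≤ C := by simpa using (norm_nonneg _).trans (hb 0)
  have h1 : ∀ R : ℝ, 1 ≤ R → ‖iteratedDeriv k v 0‖ ≤ (k.factorial * C * 2 ^ N) * R⁻¹ := by
    intro R hR
    have hR0 : 0 < R := by linarith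
    have := Complex.norm_iteratedDeriv_le_of_forall_mem_sphere_norm_le (c := 0) (C := C * (2 * R) ^ N)
      k hR0 hv.diffContOnCl (fun z hz => (hb z).trans (by
        have : ‖z‖ = R := by simpa using hz
        rw [this]; gcongr; linarith))
    refine this.trans ?_
    rw [mul_pow, div_le_iff₀ (by positivity)]
    obtain ⟨m, rfl⟩ : ∃ m, k = N + 1 + m := ⟨k - (N + 1), by omega⟩
    have : R ^ N ≤ R⁻¹ * R ^ (N + 1 + m) := by
      rw [pow_add, pow_succ]
      have : 1 ≤ R ^ m := one_le_pow₀ hR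
      field_simp
      nlinarith [pow_pos hR0 N]
    calc _ = (((N+1+m).factorial : ℝ) * C * 2 ^ N) * R ^ N := by ring
      _ ≤ (((N+1+m).factorial : ℝ) * C * 2 ^ N) * (R⁻¹ * R ^ (N + 1 + m)) := by gcongr
      _ = _ := by ring
  have h2 : Tendsto (fun R : ℝ => (k.factorial * C * 2 ^ N) * R⁻¹) atTop (𝓝 0) := by
    simpa using tendsto_inv_atTop_zero.const_mul (k.factorial * C * 2 ^ N : ℝ)
  have h3 := ge_of_tendsto h2 ((eventually_ge_atTop 1).mono h1)
  exact norm_le_zero_iff.1 h3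

theorem exists_mvPolynomial_of_growth_of_analyticAt_zero {s : ℕ} {w : (Fin s → ℂ) → ℂ}
    (hw : Differentiable ℂ w) (h0 : AnalyticAt ℂ w 0) {C : ℝ} {N : ℕ}
    (hb : ∀ x, ‖w x‖ ≤ C * (1 + ‖x‖) ^ N) :
    ∃ Q : MvPolynomial (Fin s) ℂ, ∀ x, w x = MvPolynomial.eval x Q := by
  obtain ⟨p, hp⟩ := h0
  choose q hq using fun k => (p k).toMultilinearMap.exists_mvPolynomial_eval_diag
  refine ⟨∑ k ∈ Finset.range (N + 1), q k, fun y => ?_⟩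
  set L : ℂ →L[ℂ] (Fin s → ℂ) := ContinuousLinearMap.toSpanSingleton ℂ y with hL
  have hv : Differentiable ℂ (w ∘ L) := hw.comp L.differentiable
  have hC : 0 ≤ C := by simpa using (norm_nonneg _).trans (hb 0)
  have hvb : ∀ t, ‖(w ∘ L) t‖ ≤ (C * (1 + ‖y‖) ^ N) * (1 + ‖t‖) ^ N := by
    intro t
    refine (hb _).trans ?_
    rw [mul_assoc, ← mul_pow]
    gcongr
    simp only [hL, ContinuousLinearMap.toSpanSingleton_apply, norm_smul]
    nlinarith [norm_nonneg y, norm_nonneg t]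
  have hs := Complex.hasSum_taylorSeries_of_entire hv 0 1
  have hpL : HasFPowerSeriesAt (w ∘ L) (p.compContinuousLinearMap L) 0 :=
    HasFPowerSeriesAt.compContinuousLinearMap (by simpa using hp)
  obtain ⟨r, hr⟩ := hpL
  have hcoef : ∀ k, iteratedDeriv k (w ∘ L) 0 = (k.factorial : ℂ) * MvPolynomial.eval y (q k) := by
    intro k
    rw [iteratedDeriv_eq_iteratedFDeriv, ← hr.factorial_smul, ← hq]
    have : (p.compContinuousLinearMap L k fun _ => (1 : ℂ)) = p k fun _ => y := by
      rw [FormalMultilinearSeries.compContinuousLinearMap_apply]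
      congr 1
      ext j
      simp [hL]
    simp [this]
  have hs2 := hs.unique (hasSum_sum_of_ne_finset_zero (s := Finset.range (N + 1)) (fun k hk => by
    rw [Complex.iteratedDeriv_eq_zero_of_growth hv hvb (by simpa using hk)]; simp))
  have hw1 : (w ∘ L) 1 = w y := by simp [hL]
  rw [hw1] at hs2
  rw [hs2, map_sum]
  refine Finset.sum_congr rfl fun k _ => ?_
  rw [hcoef k]
  simp [Nat.factorial_ne_zero]

theorem exists_mvPolynomial_of_growth {s : ℕ} {w : (Fin s → ℂ) → ℂ}
    (hw : Differentiable ℂ w) {x₀ : Fin s → ℂ} (h0 : AnalyticAt ℂ w x₀) {C : ℝ} {N : ℕ}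
    (hb : ∀ x, ‖w x‖ ≤ C * (1 + ‖x‖) ^ N) :
    ∃ Q : MvPolynomial (Fin s) ℂ, ∀ x, w x = MvPolynomial.eval x Q := by
  have hC : 0 ≤ C := by
    have h := (norm_nonneg _).trans (hb 0)
    simpa using h
  obtain ⟨Q, hQ⟩ := exists_mvPolynomial_of_growth_of_analyticAt_zero (w := fun x => w (x + x₀))
    (C := C * (1 + ‖x₀‖) ^ N) (N := N) (hw.comp (differentiable_id.add_const x₀))
    (by simpa [sub_neg_eq_add] using h0.comp_sub (-x₀))
    (fun x => by
      refine (hb _).trans ?_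
      rw [mul_assoc, ← mul_pow]
      gcongr
      nlinarith [norm_add_le x x₀, norm_nonneg x, norm_nonneg x₀, mul_nonneg (norm_nonneg x) (norm_nonneg x₀)])
  refine ⟨MvPolynomial.aeval (fun i => X i - MvPolynomial.C (x₀ i)) Q, fun x => ?_⟩
  have := hQ (x - x₀)
  simp only [sub_add_cancel] at this
  rw [this]
  have h2 : (MvPolynomial.eval x) ((MvPolynomial.aeval fun i => X i - MvPolynomial.C (x₀ i)) Q)
     = MvPolynomial.eval (fun i => MvPolynomial.eval x (X i - MvPolynomial.C (x₀ i))) Q := by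
    clear hQ this
    induction Q using MvPolynomial.induction_on <;> simp_all
  rw [h2]
  congr 2
  ext i
  simp

/-- `u` is bounded by a constant multiple of a power of the gauge `ρ`. -/
def HasPolynomialGrowth {α E : Type*} [Norm E] (ρ : α → ℝ) (u : α → E) : Prop :=
  ∃ (C : ℝ) (N : ℕ), 0 ≤ C ∧ ∀ a, ‖u a‖ ≤ C * ρ a ^ N

namespace HasPolynomialGrowth

variable {α : Type*} {ρ : α → ℝ}

theorem of_le {E F : Type*} [Norm E] [Norm F] {u : α → E} {v : α → F}
    (hv : HasPolynomialGrowth ρ v) (h : ∀ a, ‖u a‖ ≤ ‖v a‖) : HasPolynomialGrowth ρ u := by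
  obtain ⟨C, N, hC, hb⟩ := hv
  exact ⟨C, N, hC, fun a => (h a).trans (hb a)⟩

theorem const {E : Type*} [SeminormedAddCommGroup E] (c : E) :
    HasPolynomialGrowth ρ (fun _ => c) :=
  ⟨‖c‖, 0, norm_nonneg _, fun a => by simp⟩

theorem add {E : Type*} [SeminormedAddCommGroup E] {u v : α → E} (hρ : ∀ a, 1 ≤ ρ a)
    (hu : HasPolynomialGrowth ρ u) (hv : HasPolynomialGrowth ρ v) :
    HasPolynomialGrowth ρ (fun a => u a + v a) := by
  obtain ⟨C, N, hC, hb⟩ := hu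
  obtain ⟨C', N', hC', hb'⟩ := hv
  refine ⟨C + C', N + N', by positivity, fun a => (norm_add_le _ _).trans ?_⟩
  have h1 : ρ a ^ N ≤ ρ a ^ (N + N') := pow_le_pow_right₀ (hρ a) (by omega)
  have h2 : ρ a ^ N' ≤ ρ a ^ (N + N') := pow_le_pow_right₀ (hρ a) (by omega)
  rw [add_mul]
  gcongr
  · exact (hb a).trans (by gcongr)
  · exact (hb' a).trans (by gcongr)

theorem mul {E : Type*} [NormedRing E] {u v : α → E} (hρ : ∀ a, 1 ≤ ρ a)
    (hu : HasPolynomialGrowth ρ u) (hv : HasPolynomialGrowth ρ v) :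
    HasPolynomialGrowth ρ (fun a => u a * v a) := by
  obtain ⟨C, N, hC, hb⟩ := hu
  obtain ⟨C', N', hC', hb'⟩ := hv
  refine ⟨C * C', N + N', by positivity, fun a => (norm_mul_le _ _).trans ?_⟩
  have h0 : 0 ≤ ρ a := zero_le_one.trans (hρ a)
  calc ‖u a‖ * ‖v a‖ ≤ (C * ρ a ^ N) * (C' * ρ a ^ N') := by
        gcongr
        · exact hb a
        · exact hb' a
    _ = _ := by rw [pow_add]; ring

theorem sum {E ι : Type*} [SeminormedAddCommGroup E] (hρ : ∀ a, 1 ≤ ρ a) {u : ι → α → E}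
    (S : Finset ι) (hu : ∀ i ∈ S, HasPolynomialGrowth ρ (u i)) :
    HasPolynomialGrowth ρ (fun a => ∑ i ∈ S, u i a) := by
  classical
  induction S using Finset.induction_on with
  | empty => simpa using const (0 : E)
  | insert i S hi ih =>
    simp only [Finset.sum_insert hi]
    exact (hu i (by simp)).add hρ (ih fun j hj => hu j (by simp [hj]))

theorem eval_mvPolynomial (hρ : ∀ a, 1 ≤ ρ a) {s : ℕ} {x : α → Fin s → ℂ}
    (hx : ∀ i, HasPolynomialGrowth ρ (fun a => x a i)) (Q : MvPolynomial (Fin s) ℂ) :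
    HasPolynomialGrowth ρ (fun a => MvPolynomial.eval (x a) Q) := by
  induction Q using MvPolynomial.induction_on with
  | C c => simpa using const c
  | add p q hp hq => simpa using hp.add hρ hq
  | mul_X p i hp => simpa using hp.mul hρ (hx i)

end HasPolynomialGrowth

section EvalPair

variable {s : ℕ}

/-- Evaluation of a polynomial in one variable over `ℂ[x₁, …, xₛ]` at a point of `ℂˢ × ℂ`. -/
noncomputable def evalPair (y : (Fin s → ℂ) × ℂ) : Polynomial (MvPolynomial (Fin s) ℂ) →+* ℂ :=
  Polynomial.eval₂RingHom (MvPolynomial.eval y.1) y.2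

theorem evalPair_eq_eval_map (y : (Fin s → ℂ) × ℂ) (h : Polynomial (MvPolynomial (Fin s) ℂ)) :
    evalPair y h = (h.map (MvPolynomial.eval y.1)).eval y.2 := by
  simp [evalPair, Polynomial.eval_map]

@[simp] theorem evalPair_C (y : (Fin s → ℂ) × ℂ) (a : MvPolynomial (Fin s) ℂ) :
    evalPair y (Polynomial.C a) = MvPolynomial.eval y.1 a := by
  simp [evalPair]

@[simp] theorem evalPair_X (y : (Fin s → ℂ) × ℂ) : evalPair y Polynomial.X = y.2 := by
  simp [evalPair]

theorem analyticAt_eval_mvPolynomial {n : ℕ} (Q : MvPolynomial (Fin n) ℂ) (x : Fin n → ℂ) :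
    AnalyticAt ℂ (fun x => MvPolynomial.eval x Q) x :=
  AnalyticOnNhd.eval_mvPolynomial (𝕜 := ℂ) Q x (Set.mem_univ _)

theorem analyticAt_evalPair (h : Polynomial (MvPolynomial (Fin s) ℂ)) (y : (Fin s → ℂ) × ℂ) :
    AnalyticAt ℂ (fun y => evalPair y h) y := by
  induction h using Polynomial.induction_on' with
  | add p q hp hq => simpa using hp.fun_add hq
  | monomial k a =>
    simp only [← Polynomial.C_mul_X_pow_eq_monomial, map_mul, map_pow, evalPair_C, evalPair_X]
    exact ((analyticAt_eval_mvPolynomial a y.1).comp analyticAt_fst).mul (analyticAt_snd.pow k)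

theorem HasPolynomialGrowth.evalPair {α : Type*} {ρ : α → ℝ} (hρ : ∀ a, 1 ≤ ρ a)
    {y : α → (Fin s → ℂ) × ℂ} (hx : ∀ i, HasPolynomialGrowth ρ (fun a => (y a).1 i))
    (ht : HasPolynomialGrowth ρ (fun a => (y a).2)) (h : Polynomial (MvPolynomial (Fin s) ℂ)) :
    HasPolynomialGrowth ρ (fun a => evalPair (y a) h) := by
  induction h using Polynomial.induction_on with
  | C c => simpa using eval_mvPolynomial hρ hx c
  | add p q hp hq => simpa using hp.add hρ hq
  | monomial k a hk =>
    rw [pow_succ, ← mul_assoc]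
    simpa only [map_mul, evalPair_X] using hk.mul hρ ht

theorem norm_le_of_evalPair_eq_zero {p : Polynomial (MvPolynomial (Fin s) ℂ)} (hp : p.Monic)
    {y : (Fin s → ℂ) × ℂ} (h : evalPair y p = 0) :
    ‖y.2‖ ≤ (∑ k ∈ Finset.range p.natDegree, ‖MvPolynomial.eval y.1 (p.coeff k)‖) + 1 := by
  rw [evalPair_eq_eval_map] at h
  have hm := hp.map (MvPolynomial.eval y.1)
  have := Polynomial.IsRoot.norm_lt_cauchyBound hm.ne_zero h
  refine (NNReal.coe_le_coe.2 this.le).trans ?_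
  rw [Polynomial.cauchyBound, hm.leadingCoeff, hp.natDegree_map]
  simp only [nnnorm_one, div_one, NNReal.coe_add, NNReal.coe_one, add_le_add_iff_right]
  have h2 : (Finset.range p.natDegree).sup (fun k => ‖(p.map (MvPolynomial.eval y.1)).coeff k‖₊) ≤
    ∑ k ∈ Finset.range p.natDegree, ‖MvPolynomial.eval y.1 (p.coeff k)‖₊ := by
    refine Finset.sup_le fun k hk => ?_
    rw [Polynomial.coeff_map]
    exact Finset.single_le_sum (f := fun k => ‖MvPolynomial.eval y.1 (p.coeff k)‖₊) (fun _ _ => zero_le) hk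
  have h3 := NNReal.coe_le_coe.2 h2
  simpa using h3

theorem HasPolynomialGrowth.snd_of_evalPair_eq_zero {α : Type*} {ρ : α → ℝ} (hρ : ∀ a, 1 ≤ ρ a)
    {y : α → (Fin s → ℂ) × ℂ} (hx : ∀ i, HasPolynomialGrowth ρ (fun a => (y a).1 i))
    {p : Polynomial (MvPolynomial (Fin s) ℂ)} (hp : p.Monic) (h : ∀ a, _root_.evalPair (y a) p = 0) :
    HasPolynomialGrowth ρ (fun a => (y a).2) := by
  refine of_le (v := fun a => (∑ k ∈ Finset.range p.natDegree,
    ‖MvPolynomial.eval (y a).1 (p.coeff k)‖) + 1) ?_ fun a =>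
      (norm_le_of_evalPair_eq_zero hp (h a)).trans (le_abs_self _)
  exact (sum hρ _ fun k _ => (eval_mvPolynomial hρ hx (p.coeff k)).of_le (by simp)).add hρ (const 1)

theorem hasDerivAt_evalPair (p : Polynomial (MvPolynomial (Fin s) ℂ)) (y : (Fin s → ℂ) × ℂ) :
    HasDerivAt (fun t => evalPair (y.1, t) p) (evalPair y p.derivative) y.2 := by
  simp only [evalPair_eq_eval_map, ← Polynomial.derivative_map]
  exact Polynomial.hasDerivAt _ _

theorem exists_implicit_root (p : Polynomial (MvPolynomial (Fin s) ℂ)) {y : (Fin s → ℂ) × ℂ}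
    (h : evalPair y p = 0) (h' : evalPair y p.derivative ≠ 0) :
    ∃ φ : (Fin s → ℂ) → ℂ, AnalyticAt ℂ φ y.1 ∧ φ y.1 = y.2 ∧
      ∀ᶠ z in 𝓝 y, (evalPair z p = 0 ↔ φ z.1 = z.2) := by
  have han := analyticAt_evalPair p y
  have hcd : ContDiffAt ℂ ⊤ (fun z => evalPair z p) y := han.contDiffAt
  have hinv : (fderiv ℂ (fun z => evalPair z p) y ∘L .inr ℂ (Fin s → ℂ) ℂ).IsInvertible := by
    refine ⟨ContinuousLinearEquiv.unitsEquivAut ℂ (Units.mk0 _ h'), ?_⟩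
    ext
    have h1 := han.differentiableAt.hasFDerivAt
    have h2 : HasDerivAt (fun t : ℂ => ((y.1, t) : (Fin s → ℂ) × ℂ)) (0, 1) y.2 :=
      (hasDerivAt_const _ _).prodMk (hasDerivAt_id _)
    have h3 := HasFDerivAt.comp_hasDerivAt (x := y.2) (f := fun t : ℂ => ((y.1, t) : (Fin s → ℂ) × ℂ)) h1 h2
    have h4 := h3.unique (hasDerivAt_evalPair p y)
    simp [h4]
  refine ⟨hcd.implicitFunction (by simp) hinv, ?_, hcd.implicitFunction_apply_self _ hinv, ?_⟩
  · exact (hcd.contDiffAt_implicitFunction _ hinv).analyticAt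
  · simpa [h] using hcd.eventually_apply_eq_iff_implicitFunction (by simp) hinv

end EvalPair

theorem DifferentiableOn.eq_zero_of_convex {E : Type*} [NormedAddCommGroup E] [NormedSpace ℂ E]
    {U : Set E} (hU : IsOpen U) (hc : Convex ℝ U) {F : E → ℂ} (hF : DifferentiableOn ℂ F U) {x : E}
    (hx : x ∈ U) (h : ∀ᶠ z in 𝓝 x, F z = 0) : ∀ z ∈ U, F z = 0 := by
  intro z hz
  set ℓ : ℂ → E := fun t => x + t • (z - x) with hℓ
  have hℓc : Continuous ℓ := by fun_prop
  have hT : IsOpen (ℓ ⁻¹' U) := hU.preimage hℓc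
  have hTc : Convex ℝ (ℓ ⁻¹' U) := by
    intro t ht t' ht' a b ha hb hab
    have := hc ht ht' ha hb hab
    simp only [Set.mem_preimage, hℓ] at this ⊢
    convert this using 1
    have hxab : a • x + b • x = x := by rw [← add_smul, hab, one_smul]
    rw [add_smul, smul_add, smul_add, smul_assoc, smul_assoc, add_add_add_comm, hxab]
  have hd : DifferentiableOn ℂ (F ∘ ℓ) (ℓ ⁻¹' U) :=
    hF.comp (by fun_prop) (Set.mapsTo_preimage _ _)
  have h0 : ∀ᶠ t in 𝓝 (0 : ℂ), (F ∘ ℓ) t = 0 := by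
    have : Tendsto ℓ (𝓝 0) (𝓝 x) := by simpa [hℓ] using hℓc.tendsto 0
    exact this.eventually h
  have := (hd.analyticOnNhd hT).eqOn_zero_of_preconnected_of_eventuallyEq_zero
    hTc.isPreconnected (z₀ := 0) (by simpa [hℓ] using hx) h0
  simpa [hℓ] using this (show (1 : ℂ) ∈ ℓ ⁻¹' U by simpa [hℓ] using hz)

section Unramified

variable {s : ℕ} {p : Polynomial (MvPolynomial (Fin s) ℂ)} {Δ : MvPolynomial (Fin s) ℂ}
  {U W : Polynomial (MvPolynomial (Fin s) ℂ)}

theorem evalPair_mul_derivative (hΔ : Polynomial.C Δ = U * p + W * p.derivative)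
    {y : (Fin s → ℂ) × ℂ} (hy : evalPair y p = 0) :
    evalPair y W * evalPair y p.derivative = MvPolynomial.eval y.1 Δ := by
  have := congrArg (evalPair y) hΔ
  simp only [map_add, map_mul, evalPair_C, hy, mul_zero, zero_add] at this
  exact this.symm

theorem card_roots_toFinset_map_eval (hp : p.Monic)
    (hΔ : Polynomial.C Δ = U * p + W * p.derivative) {x : Fin s → ℂ}
    (hx : MvPolynomial.eval x Δ ≠ 0) :
    (p.map (MvPolynomial.eval x)).roots.toFinset.card = p.natDegree := by
  have hsep : (p.map (MvPolynomial.eval x)).Separable := by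
    have h := congrArg (Polynomial.map (MvPolynomial.eval x)) hΔ
    simp only [Polynomial.map_add, Polynomial.map_mul, Polynomial.map_C,
      ← Polynomial.derivative_map] at h
    refine ⟨Polynomial.C (MvPolynomial.eval x Δ)⁻¹ * U.map (MvPolynomial.eval x),
      Polynomial.C (MvPolynomial.eval x Δ)⁻¹ * W.map (MvPolynomial.eval x), ?_⟩
    rw [mul_assoc, mul_assoc, ← mul_add, ← h, ← Polynomial.C_mul, inv_mul_cancel₀ hx,
      Polynomial.C_1]
  rw [Multiset.toFinset_card_of_nodup (Polynomial.nodup_roots hsep),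
    ← (IsAlgClosed.splits _).natDegree_eq_card_roots, hp.natDegree_map]

theorem mem_roots_toFinset_iff_evalPair (hp : p.Monic) {x : Fin s → ℂ} {t : ℂ} :
    t ∈ (p.map (MvPolynomial.eval x)).roots.toFinset ↔ evalPair (x, t) p = 0 := by
  rw [Multiset.mem_toFinset, Polynomial.mem_roots (hp.map _).ne_zero, evalPair_eq_eval_map]
  rfl

theorem dvd_of_forall_evalPair_eq_zero (hp : p.Monic) (h0 : Δ ≠ 0)
    (hΔ : Polynomial.C Δ = U * p + W * p.derivative)
    {G : Polynomial (MvPolynomial (Fin s) ℂ)}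
    (hG : ∀ y : (Fin s → ℂ) × ℂ, MvPolynomial.eval y.1 Δ ≠ 0 → evalPair y p = 0 →
      evalPair y G = 0) : p ∣ G := by
  rw [← Polynomial.modByMonic_eq_zero_iff_dvd hp]
  set r := G %ₘ p with hr
  by_contra hne
  have hdeg : r.natDegree < p.natDegree := by
    refine Polynomial.natDegree_lt_natDegree hne (Polynomial.degree_modByMonic_lt _ hp)
  have hrx : ∀ x, MvPolynomial.eval x Δ ≠ 0 → r.map (MvPolynomial.eval x) = 0 := by
    intro x hx
    refine Polynomial.eq_zero_of_natDegree_lt_card_of_eval_eq_zero' _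
      (p.map (MvPolynomial.eval x)).roots.toFinset (fun t ht => ?_) ?_
    · rw [mem_roots_toFinset_iff_evalPair hp] at ht
      have h1 := hG (x, t) hx ht
      rw [← Polynomial.modByMonic_add_div G p] at h1
      simp only [map_add, map_mul, ht, zero_mul, add_zero] at h1
      rwa [evalPair_eq_eval_map] at h1
    · rw [card_roots_toFinset_map_eval hp hΔ hx]
      exact Polynomial.natDegree_map_le.trans_lt hdeg
  refine hne (Polynomial.ext fun k => ?_)
  have : r.coeff k * Δ = 0 := by
    refine MvPolynomial.funext fun x => ?_
    by_cases hx : MvPolynomial.eval x Δ = 0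
    · simp [hx]
    · have := congrArg (Polynomial.coeff · k) (hrx x hx)
      simp only [Polynomial.coeff_map, Polynomial.coeff_zero] at this
      simp [this]
  simpa [h0] using this

theorem exists_local_roots (hp : p.Monic) (hΔ : Polynomial.C Δ = U * p + W * p.derivative)
    {x : Fin s → ℂ} (hx : MvPolynomial.eval x Δ ≠ 0) :
    ∃ φ : ℂ → (Fin s → ℂ) → ℂ,
      (∀ t ∈ (p.map (MvPolynomial.eval x)).roots.toFinset, AnalyticAt ℂ (φ t) x ∧ φ t x = t ∧
        ∀ᶠ x' in 𝓝 x, evalPair (x', φ t x') p = 0) ∧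
      ∀ᶠ x' in 𝓝 x, Set.InjOn (fun t => φ t x') (p.map (MvPolynomial.eval x)).roots.toFinset ∧
        (p.map (MvPolynomial.eval x')).roots.toFinset =
          (p.map (MvPolynomial.eval x)).roots.toFinset.image (fun t => φ t x') := by
  classical
  set R := (p.map (MvPolynomial.eval x)).roots.toFinset with hR
  have key : ∀ t ∈ R, ∃ φ : (Fin s → ℂ) → ℂ, AnalyticAt ℂ φ x ∧ φ x = t ∧
      ∀ᶠ x' in 𝓝 x, evalPair (x', φ x') p = 0 := by
    intro t ht
    rw [hR, mem_roots_toFinset_iff_evalPair hp] at ht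
    obtain ⟨φ, h1, h2, h3⟩ := exists_implicit_root p (y := (x, t)) ht (fun h0 => hx (by
      rw [← evalPair_mul_derivative hΔ ht, h0, mul_zero]))
    refine ⟨φ, h1, h2, ?_⟩
    have : Tendsto (fun x' => (x', φ x')) (𝓝 x) (𝓝 (x, t)) := by
      rw [nhds_prod_eq]
      refine tendsto_id.prodMk ?_
      simpa [h2] using h1.continuousAt.tendsto
    filter_upwards [this.eventually h3] with x' hx'
    exact hx'.2 rfl
  choose! φ hφ using key
  refine ⟨φ, hφ, ?_⟩
  have hinj : ∀ᶠ x' in 𝓝 x, ∀ t ∈ R, ∀ t' ∈ R, t ≠ t' → φ t x' ≠ φ t' x' := by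
    rw [Finset.eventually_all]
    intro t ht
    rw [Finset.eventually_all]
    intro t' ht'
    by_cases h : t = t'
    · simp [h]
    · have h1 := (hφ t ht).1.continuousAt
      have h2 := (hφ t' ht').1.continuousAt
      have h3 : φ t x - φ t' x ≠ 0 := by rwa [(hφ t ht).2.1, (hφ t' ht').2.1, sub_ne_zero]
      filter_upwards [(h1.sub h2).eventually_ne h3] with x' hx' _
      exact sub_ne_zero.1 hx'
  have hroot : ∀ᶠ x' in 𝓝 x, ∀ t ∈ R, evalPair (x', φ t x') p = 0 := by
    rw [Finset.eventually_all]
    exact fun t ht => (hφ t ht).2.2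
  have hΔ' : ∀ᶠ x' in 𝓝 x, MvPolynomial.eval x' Δ ≠ 0 :=
    (analyticAt_eval_mvPolynomial Δ x).continuousAt.eventually_ne hx
  filter_upwards [hinj, hroot, hΔ'] with x' h1 h2 h3
  have hI : Set.InjOn (fun t => φ t x') R := by
    intro t ht t' ht' h
    by_contra hne
    exact h1 t ht t' ht' hne h
  refine ⟨hI, (Finset.eq_of_subset_of_card_le ?_ ?_).symm⟩
  · intro u hu
    obtain ⟨t, ht, rfl⟩ := Finset.mem_image.1 hu
    exact (mem_roots_toFinset_iff_evalPair hp).2 (h2 t ht)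
  · rw [Finset.card_image_of_injOn hI, hR, card_roots_toFinset_map_eval hp hΔ hx,
      card_roots_toFinset_map_eval hp hΔ h3]

/-- The part of the hypersurface `p = 0` lying over the locus `Δ ≠ 0`. -/
def unramifiedLocus (p : Polynomial (MvPolynomial (Fin s) ℂ)) (Δ : MvPolynomial (Fin s) ℂ) :
    Set ((Fin s → ℂ) × ℂ) :=
  {y | MvPolynomial.eval y.1 Δ ≠ 0 ∧ evalPair y p = 0}

/-- The sum of a function over the roots of `p` above a given point. -/
noncomputable def rootSum (p : Polynomial (MvPolynomial (Fin s) ℂ)) (H : (Fin s → ℂ) × ℂ → ℂ)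
    (x : Fin s → ℂ) : ℂ :=
  ∑ t ∈ (p.map (MvPolynomial.eval x)).roots.toFinset, H (x, t)

theorem analyticAt_rootSum (hp : p.Monic) (hΔ : Polynomial.C Δ = U * p + W * p.derivative)
    {g : (Fin s → ℂ) × ℂ → ℂ}
    (hg : ∀ y ∈ unramifiedLocus p Δ, ∀ᶠ z in 𝓝[unramifiedLocus p Δ] y, g z = g y)
    (h : Polynomial (MvPolynomial (Fin s) ℂ)) {x : Fin s → ℂ} (hx : MvPolynomial.eval x Δ ≠ 0) :
    AnalyticAt ℂ (rootSum p fun y => g y * evalPair y h) x := by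
  obtain ⟨φ, hφ, hev⟩ := exists_local_roots hp hΔ hx
  set R := (p.map (MvPolynomial.eval x)).roots.toFinset with hR
  have hΔ' : ∀ᶠ x' in 𝓝 x, MvPolynomial.eval x' Δ ≠ 0 :=
    (analyticAt_eval_mvPolynomial Δ x).continuousAt.eventually_ne hx
  have hgφ : ∀ᶠ x' in 𝓝 x, ∀ t ∈ R, g (x', φ t x') = g (x, t) := by
    rw [Finset.eventually_all]
    intro t ht
    obtain ⟨h1, h2, h3⟩ := hφ t ht
    have hty : (x, t) ∈ unramifiedLocus p Δ := ⟨hx, (mem_roots_toFinset_iff_evalPair hp).1 ht⟩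
    have : Tendsto (fun x' => (x', φ t x')) (𝓝 x) (𝓝[unramifiedLocus p Δ] (x, t)) := by
      refine tendsto_nhdsWithin_iff.2 ⟨?_, ?_⟩
      · rw [nhds_prod_eq]
        refine tendsto_id.prodMk ?_
        simpa [h2] using h1.continuousAt.tendsto
      · filter_upwards [h3, hΔ'] with x' a b using ⟨b, a⟩
    exact this.eventually (hg _ hty)
  have han : AnalyticAt ℂ (fun x' => ∑ t ∈ R, g (x, t) * evalPair (x', φ t x') h) x := by
    refine Finset.analyticAt_fun_sum _ fun t ht => analyticAt_const.mul ?_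
    exact (analyticAt_evalPair h _).comp (f := fun x' => (x', φ t x')) (analyticAt_id.prod (hφ t ht).1)
  refine han.congr ?_
  filter_upwards [hev, hgφ] with x' ⟨h1, h2⟩ h3
  rw [rootSum, h2, Finset.sum_image h1]
  exact Finset.sum_congr rfl fun t ht => by rw [h3 t ht]

end Unramified

section Connected

variable {s : ℕ} {p : Polynomial (MvPolynomial (Fin s) ℂ)} {Δ : MvPolynomial (Fin s) ℂ}
  {U W : Polynomial (MvPolynomial (Fin s) ℂ)}

theorem norm_rootSum_le (hp : p.Monic) {g : (Fin s → ℂ) × ℂ → ℂ} (hg : ∀ y, ‖g y‖ ≤ 1)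
    (h : Polynomial (MvPolynomial (Fin s) ℂ)) :
    ∃ (C : ℝ) (N : ℕ), 0 ≤ C ∧ ∀ x, ‖rootSum p (fun y => g y * evalPair y h) x‖ ≤
      C * (1 + ‖x‖) ^ N := by
  have hρ : ∀ a : {y : (Fin s → ℂ) × ℂ // evalPair y p = 0}, 1 ≤ 1 + ‖a.1.1‖ := fun a => by
    linarith [norm_nonneg a.1.1]
  have hx : ∀ i, HasPolynomialGrowth (fun a : {y : (Fin s → ℂ) × ℂ // evalPair y p = 0} =>
      1 + ‖a.1.1‖) (fun a => a.1.1 i) := fun i => ⟨1, 1, zero_le_one, fun a => by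
    have := norm_le_pi_norm a.1.1 i
    simp only [pow_one, one_mul]
    linarith⟩
  obtain ⟨C, N, hC, hb⟩ := HasPolynomialGrowth.evalPair hρ hx
    (HasPolynomialGrowth.snd_of_evalPair_eq_zero hρ hx hp fun a => a.2) h
  refine ⟨p.natDegree * C, N, by positivity, fun x => ?_⟩
  have hcard : (p.map (MvPolynomial.eval x)).roots.toFinset.card ≤ p.natDegree :=
    (Multiset.toFinset_card_le _).trans ((Polynomial.card_roots' _).trans Polynomial.natDegree_map_le)
  have hterm : ∀ t ∈ (p.map (MvPolynomial.eval x)).roots.toFinset,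
      ‖g (x, t) * evalPair (x, t) h‖ ≤ C * (1 + ‖x‖) ^ N := by
    intro t ht
    rw [norm_mul]
    have h1 := hb ⟨(x, t), (mem_roots_toFinset_iff_evalPair hp).1 ht⟩
    calc _ ≤ 1 * ‖evalPair (x, t) h‖ := by gcongr; exact hg _
      _ ≤ _ := by simpa using h1
  refine (norm_sum_le_of_le _ hterm).trans ?_
  rw [Finset.sum_const, nsmul_eq_mul, mul_assoc]
  gcongr

theorem exists_mvPolynomial_rootSum (hp : p.Monic) (h0 : Δ ≠ 0)
    (hΔ : Polynomial.C Δ = U * p + W * p.derivative)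
    {g : (Fin s → ℂ) × ℂ → ℂ} (hg1 : ∀ y, ‖g y‖ ≤ 1)
    (hg : ∀ y ∈ unramifiedLocus p Δ, ∀ᶠ z in 𝓝[unramifiedLocus p Δ] y, g z = g y)
    (h : Polynomial (MvPolynomial (Fin s) ℂ)) :
    ∃ Q : MvPolynomial (Fin s) ℂ, ∀ x, MvPolynomial.eval x Q =
      MvPolynomial.eval x Δ ^ 2 * rootSum p (fun y => g y * evalPair y h) x := by
  obtain ⟨C, N, hC, hb⟩ := norm_rootSum_le hp hg1 h
  set u := rootSum p (fun y => g y * evalPair y h) with hu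
  have hana : ∀ x, MvPolynomial.eval x Δ ≠ 0 →
      AnalyticAt ℂ (fun x => MvPolynomial.eval x Δ ^ 2 * u x) x := fun x hx =>
    ((analyticAt_eval_mvPolynomial Δ x).pow 2).mul (analyticAt_rootSum hp hΔ hg h hx)
  have hdiff : Differentiable ℂ (fun x => MvPolynomial.eval x Δ ^ 2 * u x) := by
    intro x
    by_cases hx : MvPolynomial.eval x Δ = 0
    · have hd := (analyticAt_eval_mvPolynomial Δ x).differentiableAt
      have h1 : (fun x' => MvPolynomial.eval x' Δ) =O[𝓝 x] fun x' => x' - x := by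
        simpa [hx] using hd.isBigO_sub
      have h2 : (fun x' => MvPolynomial.eval x' Δ * u x') =o[𝓝 x] fun _ => (1 : ℝ) := by
        rw [Asymptotics.isLittleO_one_iff]
        have hcont : Tendsto (fun x' : Fin s → ℂ => ‖MvPolynomial.eval x' Δ‖ *
            (C * (1 + ‖x'‖) ^ N)) (𝓝 x) (𝓝 0) := by
          have h3 : Continuous fun x' : Fin s → ℂ => (C * (1 + ‖x'‖) ^ N) := by fun_prop
          simpa [hx] using hd.continuousAt.norm.tendsto.mul h3.continuousAt.tendsto
        refine squeeze_zero_norm (fun x' => ?_) hcont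
        rw [norm_mul]
        gcongr
        exact hb x'
      have h3 := h1.norm_right.mul_isLittleO h2
      refine HasFDerivAt.differentiableAt (f' := 0) (HasFDerivAt.of_isLittleO ?_)
      refine Asymptotics.IsLittleO.congr' (f₁ := fun x' => MvPolynomial.eval x' Δ *
        (MvPolynomial.eval x' Δ * u x')) (g₁ := fun x' => x' - x) ?_ (.of_forall fun x' => ?_) .rfl
      · rw [← Asymptotics.isLittleO_norm_right]
        simpa only [mul_one] using h3
      · simp [hx]; ring
    · exact (hana x hx).differentiableAt
  obtain ⟨x₀, hx₀⟩ : ∃ x, MvPolynomial.eval x Δ ≠ 0 := by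
    by_contra! hall
    exact h0 (MvPolynomial.funext fun x => by simp [hall x])
  have hgr : HasPolynomialGrowth (fun x : Fin s → ℂ => 1 + ‖x‖)
      (fun x => MvPolynomial.eval x Δ ^ 2 * u x) := by
    have hρ : ∀ x : Fin s → ℂ, 1 ≤ 1 + ‖x‖ := fun x => by linarith [norm_nonneg x]
    have h1 : HasPolynomialGrowth (fun x : Fin s → ℂ => 1 + ‖x‖) u := ⟨C, N, hC, hb⟩
    refine HasPolynomialGrowth.mul hρ ?_ h1
    simp only [← map_pow]
    refine HasPolynomialGrowth.eval_mvPolynomial hρ (x := fun x => x) (fun i => ?_) _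
    refine ⟨1, 1, zero_le_one, fun x => ?_⟩
    have := norm_le_pi_norm x i
    simp only [pow_one, one_mul]
    linarith
  obtain ⟨C', N', -, hb'⟩ := hgr
  obtain ⟨Q, hQ⟩ := exists_mvPolynomial_of_growth hdiff (hana x₀ hx₀) hb'
  exact ⟨Q, fun x => (hQ x).symm⟩

theorem exists_evalPair_divided_difference (p : Polynomial (MvPolynomial (Fin s) ℂ)) :
    ∃ (m : ℕ) (q : ℕ → Polynomial (MvPolynomial (Fin s) ℂ)),
      (∀ x t t', (t' - t) * ∑ j ∈ Finset.range m, evalPair (x, t) (q j) * t' ^ j =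
        evalPair (x, t') p - evalPair (x, t) p) ∧
      ∀ x t, ∑ j ∈ Finset.range m, evalPair (x, t) (q j) * t ^ j =
        evalPair (x, t) p.derivative := by
  set P : Polynomial (Polynomial (MvPolynomial (Fin s) ℂ)) := p.map Polynomial.C with hP
  set q := P /ₘ (Polynomial.X - Polynomial.C Polynomial.X) with hq
  have hev : P.eval Polynomial.X = p := by
    rw [hP, Polynomial.eval_map, Polynomial.eval₂_C_X]
  have hdiv : (Polynomial.X - Polynomial.C Polynomial.X) * q + Polynomial.C p = P := by
    rw [hq]
    conv_rhs => rw [← Polynomial.modByMonic_add_div P (Polynomial.X - Polynomial.C Polynomial.X)]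
    rw [Polynomial.modByMonic_X_sub_C_eq_C_eval, hev, add_comm]
  have hder : q.eval Polynomial.X = p.derivative := by
    have := congrArg (fun r => (Polynomial.derivative r).eval Polynomial.X) hdiv
    simp only [Polynomial.derivative_add, Polynomial.derivative_mul, Polynomial.derivative_sub,
      Polynomial.derivative_X, Polynomial.derivative_C, sub_zero, one_mul, add_zero,
      Polynomial.eval_add, Polynomial.eval_mul, Polynomial.eval_sub, Polynomial.eval_X,
      Polynomial.eval_C, sub_self, zero_mul, hP, Polynomial.derivative_map] at this
    rw [this, Polynomial.eval_map, Polynomial.eval₂_C_X]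
  have hsum : ∀ x t t', ∑ j ∈ Finset.range (q.natDegree + 1), evalPair (x, t) (q.coeff j) * t' ^ j =
      q.eval₂ (evalPair (x, t)) t' := fun x t t' => by
    rw [Polynomial.eval₂_eq_sum_range]
  refine ⟨q.natDegree + 1, q.coeff, fun x t t' => ?_, fun x t => ?_⟩
  · rw [hsum]
    have := congrArg (Polynomial.eval₂ (evalPair (x, t)) t') hdiv
    simp only [Polynomial.eval₂_add, Polynomial.eval₂_mul, Polynomial.eval₂_sub, Polynomial.eval₂_X,
      Polynomial.eval₂_C, evalPair_X] at this
    rw [eq_sub_iff_add_eq, this, hP, Polynomial.eval₂_map]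
    have hc : (evalPair (x, t)).comp Polynomial.C = MvPolynomial.eval x :=
      RingHom.ext fun a => by simp
    rw [hc]
    rfl
  · rw [hsum, ← hder]
    have := Polynomial.hom_eval₂ q (RingHom.id _) (evalPair (x, t)) Polynomial.X
    simpa [Polynomial.eval₂_id] using this.symm

theorem eq_zero_or_eq_one_on_unramifiedLocus (hp : p.Monic) (hprime : Prime p) (h0 : Δ ≠ 0)
    (hΔ : Polynomial.C Δ = U * p + W * p.derivative)
    {g : (Fin s → ℂ) × ℂ → ℂ} (hg01 : ∀ y, g y = 0 ∨ g y = 1)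
    (hg : ∀ y ∈ unramifiedLocus p Δ, ∀ᶠ z in 𝓝[unramifiedLocus p Δ] y, g z = g y) :
    (∀ y ∈ unramifiedLocus p Δ, g y = 0) ∨ ∀ y ∈ unramifiedLocus p Δ, g y = 1 := by
  have hg1 : ∀ y, ‖g y‖ ≤ 1 := fun y => by rcases hg01 y with h | h <;> simp [h]
  obtain ⟨m, q, hq1, hq2⟩ := exists_evalPair_divided_difference p
  choose Q hQ using fun j => exists_mvPolynomial_rootSum hp h0 hΔ hg1 hg (W * q j)
  set E : Polynomial (MvPolynomial (Fin s) ℂ) :=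
    ∑ j ∈ Finset.range m, Polynomial.C (Q j) * Polynomial.X ^ j with hE
  have hEy : ∀ y ∈ unramifiedLocus p Δ, evalPair y E = MvPolynomial.eval y.1 Δ ^ 3 * g y := by
    rintro ⟨x, t'⟩ ⟨hx, hy⟩
    have h1 : evalPair (x, t') E = MvPolynomial.eval x Δ ^ 2 *
        ∑ t ∈ (p.map (MvPolynomial.eval x)).roots.toFinset, g (x, t) * evalPair (x, t) W *
          ∑ j ∈ Finset.range m, evalPair (x, t) (q j) * t' ^ j := by
      simp only [hE, map_sum, map_mul, map_pow, evalPair_C, evalPair_X, hQ, rootSum]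
      simp only [Finset.mul_sum, Finset.sum_mul]
      rw [Finset.sum_comm]
      exact Finset.sum_congr rfl fun _ _ => Finset.sum_congr rfl fun _ _ => by ring
    rw [h1, Finset.sum_eq_single t', hq2, mul_assoc, evalPair_mul_derivative hΔ hy]
    · ring
    · intro t ht hne
      have h2 := hq1 x t t'
      rw [hy, (mem_roots_toFinset_iff_evalPair hp).1 ht, sub_zero] at h2
      rw [(mul_eq_zero.1 h2).resolve_left (sub_ne_zero.2 hne.symm), mul_zero]
    · exact fun hn => absurd ((mem_roots_toFinset_iff_evalPair hp).2 hy) hn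
  have hdvd : p ∣ E * (E - Polynomial.C (Δ ^ 3)) := by
    refine dvd_of_forall_evalPair_eq_zero hp h0 hΔ fun y hy1 hy2 => ?_
    rw [map_mul, map_sub, hEy y ⟨hy1, hy2⟩, evalPair_C, map_pow]
    rcases hg01 y with h | h <;> simp [h]
  refine (hprime.dvd_or_dvd hdvd).imp (fun ⟨r, hr⟩ y hy => ?_) fun ⟨r, hr⟩ y hy => ?_
  · have := hEy y hy
    rw [hr, map_mul, hy.2, zero_mul, eq_comm] at this
    simpa [hy.1] using this
  · have := congrArg (evalPair y) hr
    rw [map_sub, hEy y hy, map_mul, hy.2, zero_mul, evalPair_C, map_pow, sub_eq_zero] at this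
    exact mul_left_cancel₀ (pow_ne_zero 3 hy.1) (by rw [this, mul_one])

theorem eq_zero_on_unramifiedLocus (hp : p.Monic) (hprime : Prime p) (h0 : Δ ≠ 0)
    (hΔ : Polynomial.C Δ = U * p + W * p.derivative) {F : (Fin s → ℂ) × ℂ → ℂ}
    (hF : ∀ y ∈ unramifiedLocus p Δ, ∀ᶠ z in 𝓝 y, DifferentiableAt ℂ F z)
    {y₀ : (Fin s → ℂ) × ℂ} (hy₀ : y₀ ∈ unramifiedLocus p Δ)
    (hFy₀ : ∀ᶠ z in 𝓝[unramifiedLocus p Δ] y₀, F z = 0) :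
    ∀ y ∈ unramifiedLocus p Δ, F y = 0 := by
  classical
  set Z := unramifiedLocus p Δ with hZ
  set g : (Fin s → ℂ) × ℂ → ℂ := fun y => if ∀ᶠ z in 𝓝[Z] y, F z = 0 then 1 else 0 with hgdef
  have hg : ∀ y ∈ Z, ∀ᶠ z in 𝓝[Z] y, g z = g y := by
    intro y hy
    by_cases hy1 : ∀ᶠ z in 𝓝[Z] y, F z = 0
    · filter_upwards [eventually_eventually_nhdsWithin.2 hy1] with z hz
      simp only [hgdef]
      rw [if_pos hz, if_pos hy1]
    · obtain ⟨φ, h1, h2, h3⟩ := exists_implicit_root p (y := y) hy.2 (fun h => hy.1 (by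
        rw [← evalPair_mul_derivative hΔ hy.2, h, mul_zero]))
      have ht : Tendsto (fun x' => (x', φ x')) (𝓝 y.1) (𝓝 y) := by
        rw [nhds_prod_eq]
        refine tendsto_id.prodMk ?_
        simpa [h2] using h1.continuousAt.tendsto
      have hΔ' : ∀ᶠ x' in 𝓝 y.1, MvPolynomial.eval x' Δ ≠ 0 :=
        (analyticAt_eval_mvPolynomial Δ y.1).continuousAt.eventually_ne hy.1
      have hev := (((ht.eventually h3).and hΔ').and (ht.eventually (hF y hy))).and
        h1.eventually_analyticAt
      obtain ⟨r, hr, hball⟩ := Metric.eventually_nhds_iff_ball.1 hev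
      have hN : ∀ᶠ z in 𝓝 y, z.1 ∈ Metric.ball y.1 r :=
        continuous_fst.continuousAt.eventually (Metric.ball_mem_nhds _ hr)
      filter_upwards [self_mem_nhdsWithin, nhdsWithin_le_nhds (h3.and hN)] with z hzZ ⟨hz1, hz2⟩
      have hφz : φ z.1 = z.2 := hz1.1 hzZ.2
      simp only [hgdef]
      rw [if_neg hy1, if_neg]
      intro hz
      apply hy1
      have hd : DifferentiableOn ℂ (fun x' => F (x', φ x')) (Metric.ball y.1 r) := by
        intro x' hx'
        obtain ⟨⟨-, ha⟩, hb⟩ := hball x' hx'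
        exact (DifferentiableAt.comp x' (f := fun x' => (x', φ x')) ha
          (differentiableAt_id.prodMk hb.differentiableAt)).differentiableWithinAt
      have htz : Tendsto (fun x' => (x', φ x')) (𝓝 z.1) (𝓝[Z] z) := by
        refine tendsto_nhdsWithin_iff.2 ⟨?_, ?_⟩
        · rw [nhds_prod_eq]
          refine tendsto_id.prodMk ?_
          simpa [hφz] using (hball z.1 hz2).2.continuousAt.tendsto
        · filter_upwards [Metric.isOpen_ball.mem_nhds hz2] with x' hx'
          obtain ⟨⟨⟨ha, hb⟩, -⟩, -⟩ := hball x' hx'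
          exact ⟨hb, ha.2 rfl⟩
      have hzero := hd.eq_zero_of_convex Metric.isOpen_ball (convex_ball _ _) hz2
        (htz.eventually hz)
      filter_upwards [self_mem_nhdsWithin, nhdsWithin_le_nhds (h3.and hN)] with z' hz'Z ⟨hz'1, hz'2⟩
      have := hzero z'.1 hz'2
      rwa [hz'1.1 hz'Z.2] at this
  have hg01 : ∀ y, g y = 0 ∨ g y = 1 := fun y => by
    simp only [hgdef]
    split_ifs <;> simp
  rcases eq_zero_or_eq_one_on_unramifiedLocus hp hprime h0 hΔ hg01 hg with h | h
  · have := h y₀ hy₀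
    simp only [hgdef] at this
    rw [if_pos hFy₀] at this
    exact absurd this one_ne_zero
  · intro y hy
    by_contra hne
    have := h y hy
    simp only [hgdef] at this
    rw [if_neg fun hev => hne (hev.self_of_nhdsWithin hy)] at this
    exact zero_ne_one this

end Connected

section FiniteExtension

variable {s : ℕ} {A : Type*} [CommRing A] [IsDomain A] [Algebra ℂ A]
  [Algebra (MvPolynomial (Fin s) ℂ) A] [IsScalarTower ℂ (MvPolynomial (Fin s) ℂ) A]
  [Module.Finite (MvPolynomial (Fin s) ℂ) A] [FaithfulSMul (MvPolynomial (Fin s) ℂ) A]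

theorem exists_algHom_of_evalPair_minpoly_eq_zero (σ : A) {x : Fin s → ℂ} {t : ℂ}
    (h : evalPair (x, t) (minpoly (MvPolynomial (Fin s) ℂ) σ) = 0) :
    ∃ ε : A →ₐ[ℂ] ℂ, (∀ b : MvPolynomial (Fin s) ℂ,
      ε (algebraMap _ A b) = MvPolynomial.eval x b) ∧ ε σ = t := by
  have hInt : Algebra.IsIntegral (MvPolynomial (Fin s) ℂ) A := inferInstance
  let alg : Algebra (Polynomial (MvPolynomial (Fin s) ℂ)) A := (Polynomial.aeval σ).toRingHom.toAlgebra
  have halg : ∀ q : Polynomial (MvPolynomial (Fin s) ℂ),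
      algebraMap (Polynomial (MvPolynomial (Fin s) ℂ)) A q = Polynomial.aeval σ q := fun _ => rfl
  have : IsScalarTower (MvPolynomial (Fin s) ℂ) (Polynomial (MvPolynomial (Fin s) ℂ)) A :=
    .of_algebraMap_eq fun b => by rw [halg, Polynomial.algebraMap_eq, Polynomial.aeval_C]
  have : Algebra.IsIntegral (Polynomial (MvPolynomial (Fin s) ℂ)) A :=
    Algebra.IsIntegral.tower_top (MvPolynomial (Fin s) ℂ)
  have hsurj : Function.Surjective (evalPair (x, t)) := fun c => ⟨Polynomial.C (C c), by simp⟩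
  have hmax := RingHom.ker_isMaximal_of_surjective _ hsurj
  have hker : RingHom.ker (algebraMap (Polynomial (MvPolynomial (Fin s) ℂ)) A) ≤
      RingHom.ker (evalPair (x, t)) := by
    intro q hq
    obtain ⟨r, hr⟩ := minpoly.isIntegrallyClosed_dvd (hInt.isIntegral σ) (p := q) hq
    rw [RingHom.mem_ker, hr, map_mul, h, zero_mul]
  obtain ⟨Q, hQ, hQ'⟩ := Ideal.exists_ideal_over_maximal_of_isIntegral (S := A) _ hker
  let := Ideal.Quotient.field Q
  have : Algebra.FiniteType ℂ A := .trans (S := MvPolynomial (Fin s) ℂ) inferInstance inferInstance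
  have : Module.Finite ℂ (A ⧸ Q) := finite_of_finite_type_of_isJacobsonRing ℂ (A ⧸ Q)
  let e := AlgEquiv.ofBijective (Algebra.ofId ℂ (A ⧸ Q))
    (IsAlgClosed.algebraMap_bijective_of_isIntegral (k := ℂ) (K := A ⧸ Q))
  have key : ∀ q : Polynomial (MvPolynomial (Fin s) ℂ),
      e.symm (Ideal.Quotient.mkₐ ℂ Q (Polynomial.aeval σ q)) = evalPair (x, t) q := by
    intro q
    rw [AlgEquiv.symm_apply_eq]
    have h1 : q - Polynomial.C (C (evalPair (x, t) q)) ∈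
        Q.comap (algebraMap (Polynomial (MvPolynomial (Fin s) ℂ)) A) := by
      rw [hQ', RingHom.mem_ker, map_sub, evalPair_C, eval_C, sub_self]
    rw [Ideal.mem_comap, halg, ← Ideal.Quotient.eq_zero_iff_mem, map_sub, map_sub, sub_eq_zero,
      Polynomial.aeval_C, ← MvPolynomial.algebraMap_eq, ← IsScalarTower.algebraMap_apply] at h1
    exact h1
  refine ⟨e.symm.toAlgHom.comp (Ideal.Quotient.mkₐ ℂ Q), fun b => ?_, ?_⟩
  · have := key (Polynomial.C b)
    rwa [Polynomial.aeval_C, evalPair_C] at this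
  · have := key Polynomial.X
    rwa [Polynomial.aeval_X, evalPair_X] at this

end FiniteExtension

theorem IsFractionRing.exists_forall_map_eq_C_mul (R : Type*) {K ι : Type*} [CommRing R] [IsDomain R]
    [Field K] [Algebra R K] [IsFractionRing R K] [Finite ι] (u : ι → Polynomial K) :
    ∃ (c : R) (v : ι → Polynomial R), c ≠ 0 ∧
      ∀ i, (v i).map (algebraMap R K) = Polynomial.C (algebraMap R K c) * u i := by
  classical
  have := Fintype.ofFinite ι
  choose b hb0 hb using fun i => IsLocalization.integerNormalization_spec (nonZeroDivisors R) (u i)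
  refine ⟨∏ i, b i, fun i => Polynomial.C (∏ j ∈ Finset.univ.erase i, b j) *
    IsLocalization.integerNormalization (nonZeroDivisors R) (u i),
    Finset.prod_ne_zero_iff.2 fun i _ => nonZeroDivisors.ne_zero (hb0 i), fun i => ?_⟩
  rw [Polynomial.map_mul, hb i, Polynomial.map_C, ← Finset.prod_erase_mul _ _ (Finset.mem_univ i),
    map_mul, Polynomial.C_mul, mul_assoc, Algebra.smul_def]
  rfl

theorem exists_generically_primitive_element {R S ι : Type*} [CommRing R] [IsDomain R] [CharZero R]
    [IsIntegrallyClosed R] [CommRing S] [IsDomain S] [Algebra R S] [Module.Finite R S]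
    [FaithfulSMul R S] [Finite ι] (X : ι → S) :
    ∃ (τ : S) (c : R) (q : ι → Polynomial R) (U W : Polynomial R), c ≠ 0 ∧
      Polynomial.C c = U * minpoly R τ + W * (minpoly R τ).derivative ∧
      ∀ i, algebraMap R S c * X i = Polynomial.aeval τ (q i) := by
  let K := FractionRing R
  let L := FractionRing S
  let := FractionRing.liftAlgebra R L
  have := FractionRing.isScalarTower_liftAlgebra R L
  have : Algebra.IsAlgebraic K L := isAlgebraic_of_isFractionRing R S ..
  have hloc : IsLocalization (Algebra.algebraMapSubmonoid S (nonZeroDivisors R)) L := inferInstance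
  have : FiniteDimensional K L := .of_isLocalization R S (nonZeroDivisors R)
  have : CharZero K := inferInstance
  obtain ⟨α, hα⟩ := Field.exists_primitive_element K L
  obtain ⟨τ, ⟨_, b, hb, rfl⟩, hτ⟩ := IsLocalization.exists_mk'_eq
    (Algebra.algebraMapSubmonoid S (nonZeroDivisors R)) α
  have hτα : algebraMap S L τ = algebraMap K L (algebraMap R K b) * α := by
    rw [← hτ, ← IsScalarTower.algebraMap_apply, IsScalarTower.algebraMap_apply R S L, mul_comm]
    exact (IsLocalization.mk'_spec L τ _).symm
  set β := algebraMap S L τ with hβ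
  have hb0 : algebraMap K L (algebraMap R K b) ≠ 0 := by
    rw [ne_eq, FaithfulSMul.algebraMap_eq_zero_iff, FaithfulSMul.algebraMap_eq_zero_iff]
    exact nonZeroDivisors.ne_zero hb
  have hβtop : IntermediateField.adjoin K {β} = ⊤ := by
    rw [eq_top_iff, ← hα, IntermediateField.adjoin_simple_le_iff]
    have h1 := IntermediateField.mem_adjoin_simple_self K β
    have h2 := (IntermediateField.adjoin K {β}).algebraMap_mem (algebraMap R K b)
    have h3 : α = β / algebraMap K L (algebraMap R K b) := by
      rw [hτα, mul_div_cancel_left₀ _ hb0]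
    rw [h3]
    exact div_mem h1 h2
  have hX : ∀ i, ∃ u : Polynomial K, Polynomial.aeval β u = algebraMap S L (X i) := fun i => by
    have h1 : algebraMap S L (X i) ∈ (IntermediateField.adjoin K {β}).toSubalgebra := by
      rw [hβtop]; trivial
    rw [IntermediateField.adjoin_simple_toSubalgebra_of_isAlgebraic
      (Algebra.IsAlgebraic.isAlgebraic β), Algebra.adjoin_singleton_eq_range_aeval] at h1
    exact h1
  choose u hu using hX
  have hInt : IsIntegral R τ := Algebra.IsIntegral.isIntegral τ
  have hmin : minpoly K β = (minpoly R τ).map (algebraMap R K) :=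
    minpoly.isIntegrallyClosed_eq_field_fractions K L hInt
  have hsep : (minpoly K β).Separable := Algebra.IsSeparable.isSeparable K β
  obtain ⟨U', W', hUW⟩ := hsep
  obtain ⟨c, v, hc, hv⟩ := IsFractionRing.exists_forall_map_eq_C_mul R
    (Sum.elim u (fun j : Bool => cond j U' W'))
  have hinj := Polynomial.map_injective _ (IsFractionRing.injective R K)
  refine ⟨τ, c, fun i => v (.inl i), v (.inr true), v (.inr false), hc, hinj ?_, fun i => ?_⟩
  · have h1 := hv (.inr true)
    have h2 := hv (.inr false)
    simp only [Sum.elim_inr, cond_true, cond_false] at h1 h2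
    rw [Polynomial.map_add, Polynomial.map_mul, Polynomial.map_mul, ← Polynomial.derivative_map,
      ← hmin, h1, h2, Polynomial.map_C, mul_assoc, mul_assoc, ← mul_add, hUW, mul_one]
  · apply IsFractionRing.injective S L
    have h1 := congrArg (Polynomial.aeval β) (hv (.inl i))
    simp only [Sum.elim_inl, map_mul, hu, Polynomial.aeval_C] at h1
    rw [Polynomial.aeval_map_algebraMap, hβ, Polynomial.aeval_algebraMap_apply] at h1
    rw [h1, map_mul, ← IsScalarTower.algebraMap_apply, ← IsScalarTower.algebraMap_apply]

theorem Polynomial.exists_root_norm_sub_pow_le {p : Polynomial ℂ} (hp : p.Monic)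
    (h0 : p.natDegree ≠ 0) (w : ℂ) :
    ∃ t, p.IsRoot t ∧ ‖t - w‖ ^ p.natDegree ≤ ‖p.eval w‖ := by
  have hs := IsAlgClosed.splits p
  have hcard := hs.natDegree_eq_card_roots
  have hne : p.roots.toFinset.Nonempty := by
    rw [Multiset.toFinset_nonempty, ← Multiset.card_pos, ← hcard]
    exact Nat.pos_of_ne_zero h0
  obtain ⟨t, ht, hmin⟩ := p.roots.toFinset.exists_min_image (fun t => ‖t - w‖) hne
  rw [Multiset.mem_toFinset] at ht
  refine ⟨t, Polynomial.isRoot_of_mem_roots ht, ?_⟩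
  have hnorm := map_multiset_prod (normHom : ℂ →*₀ ℝ) (p.roots.map fun x => w - x)
  rw [Multiset.map_map] at hnorm
  rw [hs.eval_eq_prod_roots_of_monic hp, hcard]
  refine le_of_le_of_eq ?_ hnorm.symm
  have := Multiset.prod_map_le_prod_map₀ (s := p.roots) (fun _ => ‖t - w‖)
    (normHom ∘ fun x => w - x) (fun _ _ => norm_nonneg _) fun x hx => by
      simpa [norm_sub_rev] using hmin x (Multiset.mem_toFinset.2 hx)
  simpa using this

section FiniteExtension

variable {s : ℕ} {A : Type*} [CommRing A] [Algebra ℂ A] [Algebra (MvPolynomial (Fin s) ℂ) A]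

theorem algHom_aeval_eq_evalPair {ε : A →ₐ[ℂ] ℂ} {x : Fin s → ℂ}
    (hε : ∀ b : MvPolynomial (Fin s) ℂ, ε (algebraMap _ A b) = MvPolynomial.eval x b) (σ : A)
    (q : Polynomial (MvPolynomial (Fin s) ℂ)) :
    ε (Polynomial.aeval σ q) = evalPair (x, ε σ) q := by
  rw [Polynomial.aeval_def, evalPair_eq_eval_map]
  have := Polynomial.hom_eval₂ q (algebraMap _ A) (ε : A →+* ℂ) σ
  have h2 : (ε : A →+* ℂ).comp (algebraMap (MvPolynomial (Fin s) ℂ) A) = MvPolynomial.eval x :=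
    RingHom.ext hε
  rw [h2] at this
  rw [Polynomial.eval_map]
  exact this

theorem algHom_algebraMap_eq_eval [IsScalarTower ℂ (MvPolynomial (Fin s) ℂ) A] (ε : A →ₐ[ℂ] ℂ) (b : MvPolynomial (Fin s) ℂ) :
    ε (algebraMap _ A b) =
      MvPolynomial.eval (fun j => ε (algebraMap (MvPolynomial (Fin s) ℂ) A (X j))) b := by
  have : ε.comp (IsScalarTower.toAlgHom ℂ (MvPolynomial (Fin s) ℂ) A) = 
    MvPolynomial.aeval (fun j => ε (algebraMap (MvPolynomial (Fin s) ℂ) A (X j))) := by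
    ext j; simp
  have := DFunLike.congr_fun this b
  simpa [MvPolynomial.aeval_eq_eval] using this

variable [Module.Finite (MvPolynomial (Fin s) ℂ) A]

theorem finite_algHom_over {n : ℕ} {X : Fin n → A}
    (hX : Function.Surjective (MvPolynomial.aeval (R := ℂ) X)) (x : Fin s → ℂ) :
    {ε : A →ₐ[ℂ] ℂ | ∀ b : MvPolynomial (Fin s) ℂ,
      ε (algebraMap _ A b) = MvPolynomial.eval x b}.Finite := by
  have hmon : ∀ i, (minpoly (MvPolynomial (Fin s) ℂ) (X i)).Monic := fun i =>
    minpoly.monic (Algebra.IsIntegral.isIntegral _)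
  have hfin : (Set.univ.pi fun i => {t : ℂ | ((minpoly (MvPolynomial (Fin s) ℂ) (X i)).map
      (MvPolynomial.eval x)).IsRoot t}).Finite := Set.Finite.pi fun i =>
    Polynomial.finite_setOfPred_isRoot ((hmon i).map _).ne_zero
  refine Set.Finite.of_finite_image (f := fun ε i => ε (X i)) (hfin.subset ?_) ?_
  · rintro _ ⟨ε, hε, rfl⟩ i -
    have := algHom_aeval_eq_evalPair hε (X i) (minpoly _ (X i))
    rw [minpoly.aeval, map_zero, evalPair_eq_eval_map] at this
    exact this.symm
  · intro ε _ ε' _ h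
    refine AlgHom.ext fun a => ?_
    obtain ⟨S, rfl⟩ := hX a
    have : ε.comp (MvPolynomial.aeval X) = ε'.comp (MvPolynomial.aeval X) := by
      ext i; simpa using congrFun h i
    exact DFunLike.congr_fun this S

theorem exists_separating_element {n : ℕ} {X : Fin n → A}
    (hX : Function.Surjective (MvPolynomial.aeval (R := ℂ) X)) {x : Fin s → ℂ} (ε₀ : A →ₐ[ℂ] ℂ) :
    ∃ σ : A, ∀ ε : A →ₐ[ℂ] ℂ, (∀ b : MvPolynomial (Fin s) ℂ,
      ε (algebraMap _ A b) = MvPolynomial.eval x b) → ε σ = ε₀ σ → ε = ε₀ := by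
  classical
  have hfin := finite_algHom_over hX x
  have : ∀ ε : A →ₐ[ℂ] ℂ, ∃ a : A, ε a = 0 ∧ (ε ≠ ε₀ → ε₀ a ≠ 0) := by
    intro ε
    by_cases h : ε = ε₀
    · exact ⟨0, map_zero _, fun h' => absurd h h'⟩
    · obtain ⟨a, ha⟩ := DFunLike.ne_iff.1 h
      refine ⟨a - algebraMap ℂ A (ε a), by simp, fun _ => ?_⟩
      simpa [sub_eq_zero] using Ne.symm ha
  choose a ha1 ha2 using this
  refine ⟨∏ ε ∈ hfin.toFinset.erase ε₀, a ε, fun ε hε h => ?_⟩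
  by_contra hne
  rw [map_prod, map_prod, Finset.prod_eq_zero (i := ε) (by simpa [hne] using hε) (ha1 ε)] at h
  exact Finset.prod_ne_zero_iff.2 (fun ε' h' => ha2 ε' (Finset.ne_of_mem_erase h')) h.symm

variable [IsDomain A] [IsScalarTower ℂ (MvPolynomial (Fin s) ℂ) A]
  [FaithfulSMul (MvPolynomial (Fin s) ℂ) A]

theorem exists_algHom_near {n : ℕ} {X : Fin n → A}
    (hX : Function.Surjective (MvPolynomial.aeval (R := ℂ) X)) (ε₀ : A →ₐ[ℂ] ℂ)
    {Δ : MvPolynomial (Fin s) ℂ} (hΔ : Δ ≠ 0) {N : Set (Fin n → ℂ)}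
    (hN : N ∈ 𝓝 fun i => ε₀ (X i)) :
    ∃ ε : A →ₐ[ℂ] ℂ, ε (algebraMap _ A Δ) ≠ 0 ∧ (fun i => ε (X i)) ∈ N := by
  set x₀ : Fin s → ℂ := fun j => ε₀ (algebraMap (MvPolynomial (Fin s) ℂ) A (MvPolynomial.X j))
  have hε₀ := algHom_algebraMap_eq_eval (s := s) ε₀
  have hne : (𝓝[{x | MvPolynomial.eval x Δ ≠ 0}] x₀).NeBot := by
    rw [← mem_closure_iff_nhdsWithin_neBot, mem_closure_iff_frequently]
    intro h
    refine hΔ (MvPolynomial.funext fun x => ?_)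
    have h1 : (fun x => MvPolynomial.eval x Δ) =ᶠ[𝓝 x₀] fun _ => 0 := by
      filter_upwards [h] with x hx using not_not.1 hx
    have h2 : AnalyticOnNhd ℂ (fun x => MvPolynomial.eval x Δ) Set.univ := fun x _ =>
      analyticAt_eval_mvPolynomial Δ x
    simpa using congrFun (h2.eq_of_eventuallyEq analyticOnNhd_const h1) x
  obtain ⟨σ, hσ⟩ := exists_separating_element (s := s) hX (x := x₀) ε₀
  have hmon : ∀ a : A, (minpoly (MvPolynomial (Fin s) ℂ) a).Monic := fun a =>
    minpoly.monic (Algebra.IsIntegral.isIntegral _)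
  set r := (minpoly (MvPolynomial (Fin s) ℂ) σ).natDegree with hr
  have hr0 : r ≠ 0 := (minpoly.natDegree_pos (Algebra.IsIntegral.isIntegral σ)).ne'
  have hex : ∀ x, ∃ ε : A →ₐ[ℂ] ℂ, (∀ b : MvPolynomial (Fin s) ℂ,
      ε (algebraMap _ A b) = MvPolynomial.eval x b) ∧
      ‖ε σ - ε₀ σ‖ ^ r ≤ ‖evalPair (x, ε₀ σ) (minpoly (MvPolynomial (Fin s) ℂ) σ)‖ := by
    intro x
    obtain ⟨t, ht, hle⟩ := Polynomial.exists_root_norm_sub_pow_le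
      ((hmon σ).map (MvPolynomial.eval x)) (by rwa [(hmon σ).natDegree_map]) (ε₀ σ)
    obtain ⟨ε, h1, h2⟩ := exists_algHom_of_evalPair_minpoly_eq_zero σ (x := x) (t := t)
      (by rw [evalPair_eq_eval_map]; exact ht)
    refine ⟨ε, h1, ?_⟩
    rwa [h2, evalPair_eq_eval_map, hr, ← (hmon σ).natDegree_map (MvPolynomial.eval x)]
  choose E hE hEσ using hex
  have htσ : Tendsto (fun x => E x σ) (𝓝 x₀) (𝓝 (ε₀ σ)) := by
    rw [tendsto_iff_norm_sub_tendsto_zero]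
    have h1 : Tendsto (fun x => ‖evalPair (x, ε₀ σ) (minpoly (MvPolynomial (Fin s) ℂ) σ)‖)
        (𝓝 x₀) (𝓝 0) := by
      have h2 : ContinuousAt (fun x => evalPair (x, ε₀ σ) (minpoly (MvPolynomial (Fin s) ℂ) σ)) x₀ :=
        ContinuousAt.comp (f := fun x => (x, ε₀ σ)) (analyticAt_evalPair _ _).continuousAt
          (by fun_prop)
      have h3 := h2.norm.tendsto
      rwa [← algHom_aeval_eq_evalPair hε₀, minpoly.aeval, map_zero, norm_zero] at h3
    have h4 := (squeeze_zero (fun x => by positivity) hEσ h1).rpow_const (p := ((r : ℝ)⁻¹))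
      (.inr (by positivity))
    simpa [Real.pow_rpow_inv_natCast _ hr0, hr0] using h4
  set Z : (Fin s → ℂ) → Fin n → ℂ := fun x i => E x (X i) with hZ
  have hZ' : ∀ x S, E x (MvPolynomial.aeval X S) = MvPolynomial.eval (Z x) S := fun x S => by
    have : (E x).comp (MvPolynomial.aeval X) = MvPolynomial.aeval (Z x) := by ext i; simp [hZ]
    simpa [MvPolynomial.aeval_eq_eval] using DFunLike.congr_fun this S
  have hbdd : ∃ C : ℝ, ∀ᶠ x in 𝓝 x₀, Z x ∈ Metric.closedBall (0 : Fin n → ℂ) C := by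
    set M : (Fin s → ℂ) → ℝ := fun x => ∑ i, ((∑ k ∈ Finset.range
      (minpoly (MvPolynomial (Fin s) ℂ) (X i)).natDegree,
      ‖MvPolynomial.eval x ((minpoly (MvPolynomial (Fin s) ℂ) (X i)).coeff k)‖) + 1)
    have hMc : ContinuousAt M x₀ := by
      refine tendsto_finsetSum _ fun i _ => (tendsto_finsetSum _ fun k _ => ?_).add_const 1
      exact (analyticAt_eval_mvPolynomial _ x₀).continuousAt.norm
    refine ⟨M x₀ + 1, ?_⟩
    filter_upwards [hMc.eventually_lt continuousAt_const (lt_add_one (M x₀))] with x hx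
    have hpos : ∀ x, 0 ≤ M x := fun x => Finset.sum_nonneg fun i _ => by positivity
    rw [mem_closedBall_zero_iff, pi_norm_le_iff_of_nonneg (by linarith [hpos x₀])]
    intro i
    refine le_trans ?_ hx.le
    have h1 := algHom_aeval_eq_evalPair (hE x) (X i) (minpoly _ (X i))
    rw [minpoly.aeval, map_zero] at h1
    refine (norm_le_of_evalPair_eq_zero (hmon (X i)) h1.symm).trans ?_
    exact Finset.single_le_sum (f := fun i => (∑ k ∈ Finset.range
      (minpoly (MvPolynomial (Fin s) ℂ) (X i)).natDegree,
      ‖MvPolynomial.eval x ((minpoly (MvPolynomial (Fin s) ℂ) (X i)).coeff k)‖) + 1)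
      (fun i _ => by positivity) (Finset.mem_univ i)
  obtain ⟨C, hC⟩ := hbdd
  have hlim : Tendsto Z (𝓝 x₀) (𝓝 fun i => ε₀ (X i)) := by
    refine (isCompact_closedBall (0 : Fin n → ℂ) C).le_nhds_of_unique_clusterPt hC fun z _ hz => ?_
    have hclus : ∀ S c, Tendsto (fun x => E x (MvPolynomial.aeval X S)) (𝓝 x₀) (𝓝 c) →
        MvPolynomial.eval z S = c := by
      intro S c hS
      have hz' : MapClusterPt z (𝓝 x₀) Z := hz
      have h1 := hz'.continuousAt_comp (f := fun z => MvPolynomial.eval z S)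
        (analyticAt_eval_mvPolynomial S z).continuousAt
      have h2 : Tendsto ((fun z => MvPolynomial.eval z S) ∘ Z) (𝓝 x₀) (𝓝 c) :=
        hS.congr fun x => hZ' x S
      have h3 := ClusterPt.mono h1 h2
      have := h3.neBot
      exact eq_of_nhds_neBot this
    have hker : ∀ S ∈ RingHom.ker (MvPolynomial.aeval (R := ℂ) X), MvPolynomial.aeval z S = 0 := by
      intro S hS
      rw [MvPolynomial.aeval_eq_eval]
      exact hclus S 0 (by simp [RingHom.mem_ker.1 hS])
    let ε : A →ₐ[ℂ] ℂ := (Ideal.Quotient.liftₐ _ (MvPolynomial.aeval z) hker).comp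
      (Ideal.quotientKerAlgEquivOfSurjective hX).symm.toAlgHom
    have hε : ∀ S, ε (MvPolynomial.aeval X S) = MvPolynomial.eval z S := fun S => by
      have : (Ideal.quotientKerAlgEquivOfSurjective hX).symm (MvPolynomial.aeval X S) =
          Ideal.Quotient.mk _ S := by
        rw [AlgEquiv.symm_apply_eq]
        rfl
      simp [ε, this]
    have : ε = ε₀ := by
      refine hσ ε (fun b => ?_) ?_
      · obtain ⟨S, hS⟩ := hX (algebraMap _ A b)
        rw [← hS, hε]
        refine hclus S _ ?_
        simp only [hS, hE]
        exact (analyticAt_eval_mvPolynomial b x₀).continuousAt.tendsto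
      · obtain ⟨S, hS⟩ := hX σ
        rw [← hS, hε]
        refine hclus S _ ?_
        rwa [hS]
    funext i
    rw [← this]
    simpa using (hε (MvPolynomial.X i)).symm
  obtain ⟨x, hx, hxN⟩ := ((eventually_mem_nhdsWithin (a := x₀)
    (s := {x | MvPolynomial.eval x Δ ≠ 0})).and (nhdsWithin_le_nhds (hlim hN))).exists
  exact ⟨E x, by rwa [hE], hxN⟩

end FiniteExtension

theorem eq_zero_of_forall_star_eq_self {n : ℕ} {r : ℝ} {h : (Fin n → ℂ) → ℂ}
    (hd : DifferentiableOn ℂ h (Metric.ball 0 r)) {K : Submodule ℂ (Fin n → ℂ)}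
    (hK : ∀ w ∈ K, star w ∈ K)
    (h0 : ∀ w ∈ Metric.ball 0 r, w ∈ K → star w = w → h w = 0) :
    ∀ w ∈ Metric.ball 0 r, w ∈ K → h w = 0 := by
  intro w hw hwK
  set x : Fin n → ℂ := (2⁻¹ : ℂ) • (w + star w) with hx
  set y : Fin n → ℂ := (-(2⁻¹ * Complex.I)) • (w - star w) with hy
  have hxr : star x = x := by
    rw [hx, star_smul, star_add, star_star, add_comm]; simp
  have hyr : star y = y := by
    rw [hy, star_smul, star_sub, star_star]; simp [← smul_neg]
  have hxK : x ∈ K := K.smul_mem _ (K.add_mem hwK (hK w hwK))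
  have hyK : y ∈ K := K.smul_mem _ (K.sub_mem hwK (hK w hwK))
  have hxw : x + Complex.I • y = w := by
    rw [hx, hy, smul_smul]
    have : Complex.I * -(2⁻¹ * Complex.I) = 2⁻¹ := by linear_combination (-2⁻¹ : ℂ) * Complex.I_mul_I
    rw [this, ← smul_add, add_add_sub_cancel, ← two_smul ℂ w, smul_smul]; simp
  have hxball : x ∈ Metric.ball (0 : Fin n → ℂ) r := by
    rw [mem_ball_zero_iff] at hw ⊢
    refine lt_of_le_of_lt ?_ hw
    rw [hx, norm_smul]
    have := norm_add_le w (star w)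
    rw [norm_star] at this
    norm_num
    linarith
  set S : Set ℂ := (fun t : ℂ => x + t • y) ⁻¹' Metric.ball 0 r with hS
  have hγ : Continuous fun t : ℂ => x + t • y := by fun_prop
  have hSo : IsOpen S := Metric.isOpen_ball.preimage hγ
  have hSc : Convex ℝ S := by
    intro t ht u hu α β hα hβ hαβ
    have h1 := convex_ball (0 : Fin n → ℂ) r ht hu hα hβ hαβ
    rw [hS, Set.mem_preimage]
    convert! h1 using 1
    have h2 : (α : ℂ) + β = 1 := by exact_mod_cast hαβ
    ext i
    simp only [Pi.add_apply, Pi.smul_apply, smul_eq_mul, Complex.real_smul]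
    linear_combination (-x i) * h2
  have h0S : (0 : ℂ) ∈ S := by simpa [hS] using hxball
  have hIS : Complex.I ∈ S := by
    rw [hS, Set.mem_preimage, hxw]; exact hw
  have hdγ : DifferentiableOn ℂ (fun t : ℂ => h (x + t • y)) S :=
    hd.comp (f := fun t : ℂ => x + t • y) (by fun_prop) fun t ht => ht
  have hfreq : ∃ᶠ t in 𝓝[≠] (0 : ℂ), h (x + t • y) = 0 := by
    have ht : Tendsto (fun k : ℕ => ((1 / ((k : ℝ) + 1) : ℝ) : ℂ)) atTop (𝓝[≠] 0) := by
      refine tendsto_nhdsWithin_iff.2 ⟨?_, .of_forall fun k => ?_⟩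
      · have := tendsto_one_div_add_atTop_nhds_zero_nat (𝕜 := ℝ)
        simpa [Function.comp_def] using (Complex.continuous_ofReal.tendsto 0).comp this
      · have : (1 / ((k : ℝ) + 1) : ℝ) ≠ 0 := by positivity
        exact Complex.ofReal_ne_zero.2 this
    refine ht.frequently (Eventually.frequently ?_)
    have h1 := (tendsto_nhdsWithin_iff.1 ht).1 (hSo.mem_nhds h0S)
    filter_upwards [h1] with k hk
    refine h0 _ hk (K.add_mem hxK (K.smul_mem _ hyK)) ?_
    rw [star_add, hxr, star_smul, hyr, Complex.star_def, Complex.conj_ofReal]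
  have := (hdγ.analyticOnNhd hSo).eqOn_zero_of_preconnected_of_frequently_eq_zero
    hSc.isPreconnected h0S hfreq hIS
  simpa [hxw] using this

theorem hasFDerivAt_eval_mvPolynomial {n : ℕ} (Q : MvPolynomial (Fin n) ℂ) (a : Fin n → ℂ) :
    HasFDerivAt (fun z => MvPolynomial.eval z Q)
      (∑ j, MvPolynomial.eval a (MvPolynomial.pderiv j Q) •
        ContinuousLinearMap.proj (R := ℂ) (φ := fun _ : Fin n => ℂ) j) a := by
  induction Q using MvPolynomial.induction_on with
  | C c =>
    have h := (hasFDerivAt_const (𝕜 := ℂ) c a).congr_fderiv (g' := ∑ j, MvPolynomial.eval a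
      (MvPolynomial.pderiv j (C c)) •
        ContinuousLinearMap.proj (R := ℂ) (φ := fun _ : Fin n => ℂ) j)
      (by ext v; simp)
    refine h.congr_of_eventuallyEq (.of_forall fun z => ?_)
    simp
  | add p q hp hq =>
    have h := (hp.add hq).congr_fderiv (g' := ∑ j, MvPolynomial.eval a
      (MvPolynomial.pderiv j (p + q)) •
        ContinuousLinearMap.proj (R := ℂ) (φ := fun _ : Fin n => ℂ) j)
      (by ext v; simp [add_mul, Finset.sum_add_distrib])
    refine h.congr_of_eventuallyEq (.of_forall fun z => ?_)
    simp
  | mul_X p i hp =>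
    have h1 : HasFDerivAt (fun z : Fin n → ℂ => z i)
      (ContinuousLinearMap.proj (R := ℂ) (φ := fun _ : Fin n => ℂ) i) a := hasFDerivAt_apply i a
    have h := (hp.mul h1).congr_fderiv (g' := ∑ j, MvPolynomial.eval a
      (MvPolynomial.pderiv j (p * X i)) •
        ContinuousLinearMap.proj (R := ℂ) (φ := fun _ : Fin n => ℂ) j) (by
      ext v
      simp only [Derivation.leibniz, pderiv_X, Pi.single_apply, smul_eq_mul, map_add, map_mul,
        eval_X, mul_ite, mul_one, mul_zero, apply_ite (MvPolynomial.eval a), map_zero,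
        _root_.sum_apply, _root_.add_apply,
        _root_.smul_apply, ContinuousLinearMap.proj_apply, add_mul, ite_mul, zero_mul,
        Finset.sum_add_distrib, Finset.mul_sum, mul_assoc]
      simp)
    refine h.congr_of_eventuallyEq (.of_forall fun z => ?_)
    simp

theorem eval_star_map_algebraMap {n : ℕ} (Q : MvPolynomial (Fin n) ℝ) (z : Fin n → ℂ) :
    MvPolynomial.eval (star z) (Q.map (algebraMap ℝ ℂ)) =
      star (MvPolynomial.eval z (Q.map (algebraMap ℝ ℂ))) := by
  induction Q using MvPolynomial.induction_on with
  | C c => simp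
  | add p q hp hq => simp [hp, hq]
  | mul_X p i hp => simp [hp]

theorem Matrix.exists_star_eq_self_right_inverse {m n : ℕ} {J : Matrix (Fin m) (Fin n) ℂ}
    (hJ : J.map star = J) (hrank : J.rank = m) :
    ∃ R : Matrix (Fin n) (Fin m) ℂ, J * R = 1 ∧ R.map star = R := by
  have hsurj : Function.Surjective J.mulVec := by
    have : LinearMap.range J.mulVecLin = ⊤ := by
      apply Submodule.eq_top_of_finrank_eq
      rw [Module.finrank_fin_fun]
      exact hrank
    exact LinearMap.range_eq_top.1 this
  obtain ⟨R, hR⟩ := Matrix.mulVec_surjective_iff_exists_right_inverse.1 hsurj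
  have hR' : J * R.map star = 1 := by
    have : (J * R).map (starRingEnd ℂ) = 1 := by rw [hR]; ext i j; simp [Matrix.one_apply]; 
    rw [Matrix.map_mul] at this
    rw [← this]
    congr 1
    exact hJ.symm
  refine ⟨(2⁻¹ : ℂ) • (R + R.map star), ?_, ?_⟩
  · rw [Matrix.mul_smul, Matrix.mul_add, hR, hR', ← two_smul ℂ (1 : Matrix _ _ ℂ), smul_smul]
    simp
  · have h2 : (starRingEnd ℂ) 2 = 2 := map_ofNat _ 2
    ext i j
    simp [add_comm, h2, mul_add]

theorem exists_local_inverse {E : Type*} [NormedAddCommGroup E] [NormedSpace ℂ E]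
    [CompleteSpace E] {Φ : E → E} {a : E} (hΦ : ContDiffAt ℂ 1 Φ a)
    (h' : HasFDerivAt Φ (ContinuousLinearMap.id ℂ E) a) :
    ∃ G : E → E, G (Φ a) = a ∧ (∀ᶠ w in 𝓝 (Φ a), DifferentiableAt ℂ G w) ∧
      (∀ᶠ z in 𝓝 a, G (Φ z) = z) ∧ ∀ᶠ w in 𝓝 (Φ a), Φ (G w) = w := by
  have h'' : HasFDerivAt Φ (ContinuousLinearEquiv.refl ℂ E : E →L[ℂ] E) a := h'
  have hs := hΦ.hasStrictFDerivAt' h'' one_ne_zero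
  refine ⟨hΦ.localInverse h'' one_ne_zero, hΦ.localInverse_apply_image h'' one_ne_zero, ?_,
    hs.eventually_left_inverse, hs.eventually_right_inverse⟩
  filter_upwards [(hΦ.to_localInverse h'' one_ne_zero).eventually (by simp)] with w hw
  exact hw.differentiableAt one_ne_zero

theorem eventually_eq_zero_near_smooth_real_point {m n : ℕ} {P : Fin m → MvPolynomial (Fin n) ℝ}
    {a : Fin n → ℂ} (haR : star a = a)
    (ha : ∀ i, MvPolynomial.eval a ((P i).map (algebraMap ℝ ℂ)) = 0)
    (hrank : Matrix.rank (Matrix.of fun (i : Fin m) (j : Fin n) =>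
      MvPolynomial.eval a (MvPolynomial.pderiv j ((P i).map (algebraMap ℝ ℂ)))) = m)
    {f : (Fin n → ℂ) → ℂ} (hf : ∀ᶠ z in 𝓝 a, DifferentiableAt ℂ f z)
    (hvan : ∀ z : Fin n → ℂ, (∀ i, MvPolynomial.eval z ((P i).map (algebraMap ℝ ℂ)) = 0) →
      star z = z → f z = 0) :
    ∀ᶠ z in 𝓝 a, (∀ i, MvPolynomial.eval z ((P i).map (algebraMap ℝ ℂ)) = 0) → f z = 0 := by
  set J : Matrix (Fin m) (Fin n) ℂ := Matrix.of fun (i : Fin m) (j : Fin n) =>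
      MvPolynomial.eval a (MvPolynomial.pderiv j ((P i).map (algebraMap ℝ ℂ))) with hJdef
  have hJ : J.map star = J := by
    ext i j
    rw [hJdef, Matrix.map_apply, Matrix.of_apply, pderiv_map, ← eval_star_map_algebraMap, haR]
  obtain ⟨R, hJR, hR⟩ := Matrix.exists_star_eq_self_right_inverse hJ hrank
  set p : (Fin n → ℂ) → Fin m → ℂ := fun z i =>
    MvPolynomial.eval z ((P i).map (algebraMap ℝ ℂ)) with hp
  have star_mulVec {k l : ℕ} {M : Matrix (Fin k) (Fin l) ℂ} (hM : M.map star = M)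
      (v : Fin l → ℂ) : star (M.mulVec v) = M.mulVec (star v) := by
    ext i
    simp only [Pi.star_apply, Matrix.mulVec, dotProduct, star_sum, star_mul']
    refine Finset.sum_congr rfl fun j _ => ?_
    have h : star (M i j) = M i j := congr_fun₂ hM i j
    rw [h]
  have hpstar (z) : p (star z) = star (p z) := by
    ext i
    exact eval_star_map_algebraMap _ _
  have hpa : p a = 0 := funext ha
  set D : (Fin n → ℂ) → Fin m → ℂ := fun z => J.mulVec (z - a) - p z with hD
  have hDa : D a = 0 := by simp [hD, hpa]
  have hDstar (z) : D (star z) = star (D z) := by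
    simp only [hD, star_sub, star_mulVec hJ, haR, hpstar]
  have hD' : HasFDerivAt D (0 : (Fin n → ℂ) →L[ℂ] Fin m → ℂ) a := by
    rw [hasFDerivAt_pi']
    intro i
    have h1 := hasFDerivAt_eval_mvPolynomial ((P i).map (algebraMap ℝ ℂ)) a
    set L := ∑ j, MvPolynomial.eval a (MvPolynomial.pderiv j ((P i).map (algebraMap ℝ ℂ))) •
        ContinuousLinearMap.proj (R := ℂ) (φ := fun _ : Fin n => ℂ) j with hL
    have h2 := ((L.hasFDerivAt (x := a)).sub_const (L a)).sub h1
    refine (h2.congr_fderiv (by ext; simp)).congr_of_eventuallyEq (.of_forall fun z => ?_)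
    simp [hD, hp, hL, hJdef, Matrix.mulVec, dotProduct, mul_sub, Finset.sum_sub_distrib]
  have hDc : ContDiff ℂ 1 D := by
    refine contDiff_pi.2 fun i => ContDiff.sub ?_ ?_
    · simp only [Matrix.mulVec, dotProduct, Pi.sub_apply]
      fun_prop
    · exact contDiff_iff_contDiffAt.2 fun z => (analyticAt_eval_mvPolynomial _ z).contDiffAt
  set Φ : (Fin n → ℂ) → Fin n → ℂ := fun z => (z - a) - R.mulVec (D z) with hΦ
  have hΦa : Φ a = 0 := by simp [hΦ, hDa]
  have hΦstar (z) : Φ (star z) = star (Φ z) := by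
    simp only [hΦ, star_sub, star_mulVec hR, haR, hDstar]
  have hJΦ (z) : J.mulVec (Φ z) = p z := by
    simp only [hΦ]
    rw [Matrix.mulVec_sub, Matrix.mulVec_mulVec, hJR, Matrix.one_mulVec]
    exact sub_sub_cancel _ _
  set RL : (Fin m → ℂ) →L[ℂ] (Fin n → ℂ) := LinearMap.toContinuousLinearMap R.mulVecLin
  have hΦc : ContDiff ℂ 1 Φ := by
    have : ContDiff ℂ 1 fun z => RL (D z) := RL.contDiff.comp hDc
    exact (contDiff_id.sub contDiff_const).sub this
  have hΦ' : HasFDerivAt Φ (ContinuousLinearMap.id ℂ _) a := by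
    have h1 : HasFDerivAt (fun z => RL (D z)) (RL.comp 0) a := RL.hasFDerivAt.comp a hD'
    have h2 := ((hasFDerivAt_id (𝕜 := ℂ) a).sub_const a).sub h1
    exact h2.congr_fderiv (by ext; simp)
  obtain ⟨G, hGa, hGd, hGΦ, hΦG⟩ := exists_local_inverse hΦc.contDiffAt hΦ'
  rw [hΦa] at hGa hGd hΦG
  have hGc : Tendsto G (𝓝 0) (𝓝 a) := by
    simpa [ContinuousAt, hGa] using hGd.self_of_nhds.continuousAt
  have hstarc : Tendsto (star : (Fin n → ℂ) → Fin n → ℂ) (𝓝 a) (𝓝 a) := by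
    simpa [ContinuousAt, haR] using (continuous_star (R := Fin n → ℂ)).continuousAt (x := a)
  have hall : ∀ᶠ w in 𝓝 (0 : Fin n → ℂ), DifferentiableAt ℂ G w ∧ Φ (G w) = w ∧
      G (Φ (star (G w))) = star (G w) ∧ DifferentiableAt ℂ f (G w) :=
    hGd.and (hΦG.and (((hstarc.comp hGc).eventually hGΦ).and (hGc.eventually hf)))
  obtain ⟨r, hr, hball⟩ := Metric.eventually_nhds_iff_ball.1 hall
  have hzero := eq_zero_of_forall_star_eq_self (r := r) (h := fun w => f (G w))
    (K := LinearMap.ker J.mulVecLin)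
    (fun w hw => ((hball w hw).2.2.2.comp w (hball w hw).1).differentiableWithinAt)
    (fun w hw => by
      rw [LinearMap.mem_ker, Matrix.mulVecLin_apply] at hw ⊢
      rw [← star_mulVec hJ, hw, star_zero])
    (fun w hw hwK hwR => by
      obtain ⟨-, h2, h3, -⟩ := hball w hw
      rw [LinearMap.mem_ker, Matrix.mulVecLin_apply] at hwK
      refine hvan _ (fun i => ?_) ?_
      · have := hJΦ (G w)
        rw [h2, hwK] at this
        exact (congr_fun this i).symm
      · rw [← h3, hΦstar, h2, hwR])
  have hΦt : Tendsto Φ (𝓝 a) (𝓝 0) := by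
    simpa [ContinuousAt, hΦa] using hΦc.continuous.continuousAt (x := a)
  filter_upwards [hGΦ, hΦt.eventually (Metric.ball_mem_nhds _ hr)] with z hz hzr hzV
  have := hzero (Φ z) hzr (by
    rw [LinearMap.mem_ker, Matrix.mulVecLin_apply, hJΦ]; exact funext hzV)
  simpa [hz] using this

theorem eq_zero_of_eventually_eq_zero {s n : ℕ} {A : Type*} [CommRing A] [IsDomain A]
    [Algebra ℂ A] [Algebra (MvPolynomial (Fin s) ℂ) A] [IsScalarTower ℂ (MvPolynomial (Fin s) ℂ) A]
    [Module.Finite (MvPolynomial (Fin s) ℂ) A] [FaithfulSMul (MvPolynomial (Fin s) ℂ) A]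
    {X : Fin n → A} (hX : Function.Surjective (MvPolynomial.aeval (R := ℂ) X))
    {f : (Fin n → ℂ) → ℂ}
    (hf : ∀ ε : A →ₐ[ℂ] ℂ, ∀ᶠ z in 𝓝 fun i => ε (X i), DifferentiableAt ℂ f z)
    {ε₀ : A →ₐ[ℂ] ℂ}
    (h0 : ∀ᶠ z in 𝓝 fun i => ε₀ (X i), ∀ ε : A →ₐ[ℂ] ℂ, (fun i => ε (X i)) = z → f z = 0)
    (ε : A →ₐ[ℂ] ℂ) : f (fun i => ε (X i)) = 0 := by
  obtain ⟨τ, Δ, q, U, W, hΔ0, hΔ, hq⟩ :=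
    exists_generically_primitive_element (R := MvPolynomial (Fin s) ℂ) X
  have hmon : (minpoly (MvPolynomial (Fin s) ℂ) τ).Monic :=
    minpoly.monic (Algebra.IsIntegral.isIntegral _)
  have hprime : Prime (minpoly (MvPolynomial (Fin s) ℂ) τ) :=
    minpoly.prime_of_isIntegrallyClosed (Algebra.IsIntegral.isIntegral _)
  set Z := unramifiedLocus (minpoly (MvPolynomial (Fin s) ℂ) τ) Δ with hZ
  set ζ : (Fin s → ℂ) × ℂ → Fin n → ℂ := fun y i => evalPair y (q i) / MvPolynomial.eval y.1 Δ
    with hζ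
  have hζ_eq {ε : A →ₐ[ℂ] ℂ} {x : Fin s → ℂ}
      (hε : ∀ b, ε (algebraMap (MvPolynomial (Fin s) ℂ) A b) = MvPolynomial.eval x b)
      (hx : MvPolynomial.eval x Δ ≠ 0) : ζ (x, ε τ) = fun i => ε (X i) := by
    ext i
    have := congrArg ε (hq i)
    rw [map_mul, hε, algHom_aeval_eq_evalPair hε] at this
    simp only [hζ, ← this]
    field_simp
  have hζ_exists {y} (hy : y ∈ Z) : ∃ ε : A →ₐ[ℂ] ℂ, (fun i => ε (X i)) = ζ y := by
    obtain ⟨ε, hε, hετ⟩ := exists_algHom_of_evalPair_minpoly_eq_zero τ hy.2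
    refine ⟨ε, ?_⟩
    rw [← hζ_eq hε hy.1, hετ]
  have hζ_mem {ε : A →ₐ[ℂ] ℂ} (hε : ε (algebraMap _ A Δ) ≠ 0) :
      ∃ y ∈ Z, ζ y = fun i => ε (X i) := by
    set x : Fin s → ℂ := fun j => ε (algebraMap (MvPolynomial (Fin s) ℂ) A (MvPolynomial.X j))
    have h (b) : ε (algebraMap (MvPolynomial (Fin s) ℂ) A b) = MvPolynomial.eval x b :=
      algHom_algebraMap_eq_eval ε b
    have hx : MvPolynomial.eval x Δ ≠ 0 := h Δ ▸ hε
    refine ⟨(x, ε τ), ⟨hx, ?_⟩, hζ_eq h hx⟩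
    rw [← algHom_aeval_eq_evalPair h, minpoly.aeval, map_zero]
  have hζd {y} (hy : y ∈ Z) : ∀ᶠ z in 𝓝 y, DifferentiableAt ℂ ζ z := by
    have hΔc : AnalyticAt ℂ (fun y : (Fin s → ℂ) × ℂ => MvPolynomial.eval y.1 Δ) y := by
      simpa using analyticAt_evalPair (Polynomial.C Δ) y
    have : AnalyticAt ℂ ζ y := AnalyticAt.pi fun i => (analyticAt_evalPair (q i) y).div hΔc hy.1
    exact this.eventually_analyticAt.mono fun z hz => hz.differentiableAt
  have hζc {y} (hy : y ∈ Z) : Tendsto ζ (𝓝 y) (𝓝 (ζ y)) :=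
    (hζd hy).self_of_nhds.continuousAt
  obtain ⟨ε₁, hε₁, hN⟩ := exists_algHom_near hX ε₀ hΔ0 h0.eventually_nhds
  obtain ⟨y₀, hy₀, hy₀X⟩ := hζ_mem hε₁
  have hF := eq_zero_on_unramifiedLocus hmon hprime hΔ0 hΔ (F := fun y => f (ζ y))
    (fun y hy => by
      obtain ⟨ε, hε⟩ := hζ_exists hy
      have h1 := hf ε
      rw [hε] at h1
      filter_upwards [hζd hy, (hζc hy).eventually h1] with z hz1 hz2
      exact hz2.comp z hz1) hy₀
    (by
      have h1 := hζc hy₀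
      rw [hy₀X] at h1
      filter_upwards [nhdsWithin_le_nhds (h1.eventually hN), self_mem_nhdsWithin] with z hz hzZ
      obtain ⟨ε, hε⟩ := hζ_exists hzZ
      exact hz ε hε)
  by_contra hne
  obtain ⟨ε₂, hε₂, hN₂⟩ := exists_algHom_near hX ε hΔ0
    ((hf ε).self_of_nhds.continuousAt.eventually_ne hne)
  obtain ⟨y, hy, hyX⟩ := hζ_mem hε₂
  exact hN₂ (by rw [← hyX]; exact hF y hy)

theorem eq_zero_of_eventually_eq_zero_of_surjective {n : ℕ} {A : Type*} [CommRing A] [IsDomain A]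
    [Algebra ℂ A] {X : Fin n → A} (hX : Function.Surjective (MvPolynomial.aeval (R := ℂ) X))
    {f : (Fin n → ℂ) → ℂ}
    (hf : ∀ ε : A →ₐ[ℂ] ℂ, ∀ᶠ z in 𝓝 fun i => ε (X i), DifferentiableAt ℂ f z)
    {ε₀ : A →ₐ[ℂ] ℂ}
    (h0 : ∀ᶠ z in 𝓝 fun i => ε₀ (X i), ∀ ε : A →ₐ[ℂ] ℂ, (fun i => ε (X i)) = z → f z = 0)
    (ε : A →ₐ[ℂ] ℂ) : f (fun i => ε (X i)) = 0 := by
  have : Algebra.FiniteType ℂ A := .of_surjective (MvPolynomial.aeval (R := ℂ) X) hX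
  obtain ⟨s, g, hginj, hgfin⟩ := exists_finite_inj_algHom_of_fg ℂ A
  let _ : Algebra (MvPolynomial (Fin s) ℂ) A := g.toRingHom.toAlgebra
  have : IsScalarTower ℂ (MvPolynomial (Fin s) ℂ) A :=
    .of_algebraMap_eq fun c => (g.commutes c).symm
  have : Module.Finite (MvPolynomial (Fin s) ℂ) A := hgfin
  have : FaithfulSMul (MvPolynomial (Fin s) ℂ) A :=
    (faithfulSMul_iff_algebraMap_injective _ _).2 hginj
  exact eq_zero_of_eventually_eq_zero (s := s) hX hf h0 ε

/-- Real points are Zariski dense in an irreducible real affine variety with a smooth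
real point: an analytic function on (a neighborhood of) `V` vanishing on `V ∩ ℝⁿ`
vanishes on all of `V`. -/
theorem analytic_vanish_on_real_points {n d : ℕ} (hd : d ≤ n)
    (P : Fin (n - d) → MvPolynomial (Fin n) ℝ)
    (hprime : (Ideal.span (Set.range fun i =>
      (P i).map (algebraMap ℝ ℂ))).IsPrime)
    (a : Fin n → ℂ)
    (ha : ∀ i, MvPolynomial.eval a ((P i).map (algebraMap ℝ ℂ)) = 0)
    (haR : ∀ j, (a j).im = 0)
    (hrank : Matrix.rank (Matrix.of fun (i : Fin (n - d)) (j : Fin n) =>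
      MvPolynomial.eval a (MvPolynomial.pderiv j ((P i).map (algebraMap ℝ ℂ)))) = n - d)
    (U : Set (Fin n → ℂ)) (hU : IsOpen U)
    (hVU : {z : Fin n → ℂ | ∀ i, MvPolynomial.eval z ((P i).map (algebraMap ℝ ℂ)) = 0} ⊆ U)
    (f : (Fin n → ℂ) → ℂ) (hf : DifferentiableOn ℂ f U)
    (hvan : ∀ z : Fin n → ℂ,
      (∀ i, MvPolynomial.eval z ((P i).map (algebraMap ℝ ℂ)) = 0) →
      (∀ j, (z j).im = 0) → f z = 0) :
    ∀ z : Fin n → ℂ,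
      (∀ i, MvPolynomial.eval z ((P i).map (algebraMap ℝ ℂ)) = 0) → f z = 0 := by
  have hfd {z : Fin n → ℂ} (hz : ∀ i, MvPolynomial.eval z ((P i).map (algebraMap ℝ ℂ)) = 0) :
      ∀ᶠ w in 𝓝 z, DifferentiableAt ℂ f w := by
    filter_upwards [hU.mem_nhds (hVU hz)] with w hw
    exact hf.differentiableAt (hU.mem_nhds hw)
  have hstar (z : Fin n → ℂ) : star z = z ↔ ∀ j, (z j).im = 0 := by
    simp only [funext_iff, Pi.star_apply, Complex.star_def, Complex.conj_eq_iff_im]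
  have hnear := eventually_eq_zero_near_smooth_real_point ((hstar a).2 haR) ha hrank (hfd ha)
    fun z hz hzR => hvan z hz ((hstar z).1 hzR)
  set I := Ideal.span (Set.range fun i => (P i).map (algebraMap ℝ ℂ)) with hI
  let A := MvPolynomial (Fin n) ℂ ⧸ I
  let X : Fin n → A := fun i => Ideal.Quotient.mk I (MvPolynomial.X i)
  have hXmk : MvPolynomial.aeval (R := ℂ) X = Ideal.Quotient.mkₐ ℂ I := by
    ext i; simp [X]; rfl
  have hX : Function.Surjective (MvPolynomial.aeval (R := ℂ) X) := by
    rw [hXmk]; exact Ideal.Quotient.mkₐ_surjective ℂ I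
  have hpoint {z : Fin n → ℂ}
      (hz : ∀ i, MvPolynomial.eval z ((P i).map (algebraMap ℝ ℂ)) = 0) :
      ∃ ε : A →ₐ[ℂ] ℂ, (fun i => ε (X i)) = z := by
    have hle : I ≤ RingHom.ker (MvPolynomial.aeval (R := ℂ) z) := by
      rw [hI, Ideal.span_le]
      rintro _ ⟨i, rfl⟩
      simpa [MvPolynomial.aeval_eq_eval] using hz i
    refine ⟨Ideal.Quotient.liftₐ I (MvPolynomial.aeval (R := ℂ) z) fun b hb => hle hb, ?_⟩
    ext i
    exact MvPolynomial.aeval_X z i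
  have hV (ε : A →ₐ[ℂ] ℂ) (i) :
      MvPolynomial.eval (fun i => ε (X i)) ((P i).map (algebraMap ℝ ℂ)) = 0 := by
    have h1 : MvPolynomial.aeval (R := ℂ) (fun i => ε (X i)) =
        ε.comp (Ideal.Quotient.mkₐ ℂ I) := by
      ext i; simp [X]; rfl
    have h2 := DFunLike.congr_fun h1 ((P i).map (algebraMap ℝ ℂ))
    rw [AlgHom.comp_apply, Ideal.Quotient.mkₐ_eq_mk,
      Ideal.Quotient.eq_zero_iff_mem.2 (Ideal.subset_span (Set.mem_range_self i)), map_zero] at h2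
    simpa [MvPolynomial.aeval_eq_eval] using h2
  obtain ⟨ε₀, hε₀⟩ := hpoint ha
  intro z hz
  obtain ⟨ε, rfl⟩ := hpoint hz
  refine eq_zero_of_eventually_eq_zero_of_surjective hX (fun ε => hfd (hV ε)) (ε₀ := ε₀) ?_ ε
  rw [hε₀]
  filter_upwards [hnear] with z hz ε hε
  exact hz (hε ▸ hV ε)
end
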